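/- arXiv:1302.5373 — 3 statements merged into one kernel-verified Lean document; each statement's English description precedes it below -/
import Mathlib

section
/- Let p be a real polynomial in n variables of total degree d ≥ 1, let ρ ∈ ℝ, and let P be an s-dimensional coordinate plane in ℝ^n (1 ≤ s ≤ n). If all critical points of the restriction p|P are non-degenerate, then p|P has at most (d−1)^s critical points, and consequently the sublevel set {x ∈ P : p(x) ≤ ρ} has at most (d−1)^s compact connected components. -/
open MvPolynomial

/-- The coordinate plane through `v` in the directions of the coordinates in `S`. -/
def coordPlane {n : ℕ} (S : Finset (Fin n)) (v : Fin n → ℝ) : Set (Fin n → ℝ) :=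
  {x | ∀ j ∉ S, x j = v j}

/-- Critical points of the restriction of `p` to the coordinate plane `coordPlane S v`:
points of the plane where all partial derivatives in the coordinate directions of the
plane vanish. -/
def critOnPlane {n : ℕ} (p : MvPolynomial (Fin n) ℝ) (S : Finset (Fin n)) (v : Fin n → ℝ) :
    Set (Fin n → ℝ) :=
  {x | x ∈ coordPlane S v ∧ ∀ j ∈ S, eval x (pderiv j p) = 0}

/-- The Hessian of the restriction of `p` to the coordinate plane with directions in `S`. -/
noncomputable def hessOnPlane {n : ℕ} (p : MvPolynomial (Fin n) ℝ) (S : Finset (Fin n))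
    (x : Fin n → ℝ) : Matrix {j // j ∈ S} {j // j ∈ S} ℝ :=
  Matrix.of fun j l : {j // j ∈ S} => eval x (pderiv (l : Fin n) (pderiv (j : Fin n) p))

namespace MvPolynomial

theorem totalDegree_pderiv_le {σ R : Type*} [CommSemiring R] (p : MvPolynomial σ R) (i : σ) :
    (pderiv i p).totalDegree ≤ p.totalDegree - 1 := by
  classical
  refine Finset.sup_le fun m hm => ?_
  rw [mem_support_iff, coeff_pderiv] at hm
  have h : m + Finsupp.single i 1 ∈ p.support :=
    mem_support_iff.2 fun h0 => hm (by simp [h0])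
  have h2 := le_totalDegree h
  rw [Finsupp.sum_add_index' (by simp) (by simp), Finsupp.sum_single_index rfl] at h2
  exact Nat.le_sub_of_add_le h2

/-- The differential of the polynomial function `eval · p` at `x`. -/
noncomputable def evalDifferential {ι : Type*} [Fintype ι] (p : MvPolynomial ι ℝ) (x : ι → ℝ) :
    (ι → ℝ) →L[ℝ] ℝ :=
  ∑ j, eval x (pderiv j p) • ContinuousLinearMap.proj j

@[simp]
theorem evalDifferential_apply {ι : Type*} [Fintype ι] (p : MvPolynomial ι ℝ) (x ξ : ι → ℝ) :
    evalDifferential p x ξ = ∑ j, eval x (pderiv j p) * ξ j := by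
  simp [evalDifferential]

theorem hasStrictFDerivAt_eval {ι : Type*} [Fintype ι] (p : MvPolynomial ι ℝ) (x : ι → ℝ) :
    HasStrictFDerivAt (fun y => eval y p) (evalDifferential p x) x := by
  classical
  induction p using MvPolynomial.induction_on with
  | C a =>
    have : evalDifferential (C a) x = 0 := by ext; simp
    rw [this]
    simpa using hasStrictFDerivAt_const a x
  | add p q hp hq =>
    have : evalDifferential (p + q) x = evalDifferential p x + evalDifferential q x := by
      ext; simp [add_mul, Finset.sum_add_distrib]
    simp only [map_add, this]
    exact hp.add hq
  | mul_X p i hp =>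
    have hX : HasStrictFDerivAt (fun y : ι → ℝ => y i) (ContinuousLinearMap.proj i) x :=
      (ContinuousLinearMap.proj (R := ℝ) (φ := fun _ : ι => ℝ) i).hasStrictFDerivAt
    simp only [map_mul, eval_X]
    refine (hp.mul hX).congr_fderiv (ContinuousLinearMap.ext fun ξ => ?_)
    simp only [evalDifferential_apply, pderiv_mul, pderiv_X, map_add, map_mul, eval_X, add_mul,
      Finset.sum_add_distrib, add_apply, smul_apply, smul_eq_mul, ContinuousLinearMap.proj_apply,
      Finset.mul_sum, Pi.single_apply]
    rw [add_comm]
    congr 1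
    · exact Finset.sum_congr rfl fun j _ => by ring
    · simp [apply_ite]

/-- Lagrange interpolation on a finite set of points. -/
theorem exists_eval_eq_on_finset {ι K : Type*} [Field K] (Z : Finset (ι → K)) (g : (ι → K) → K) :
    ∃ p : MvPolynomial ι K, p.totalDegree ≤ Z.card ∧ ∀ z ∈ Z, eval z p = g z := by
  classical
  have hsep : ∀ z w : ι → K, ∃ q : MvPolynomial ι K,
      q.totalDegree ≤ 1 ∧ (z ≠ w → eval z q = 1 ∧ eval w q = 0) := fun z w => by
    by_cases h : z = w
    · exact ⟨0, by simp, fun h' => (h' h).elim⟩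
    · obtain ⟨i, hi⟩ := Function.ne_iff.1 h
      refine ⟨C (z i - w i)⁻¹ * (X i - C (w i)), ?_, fun _ => ⟨?_, by simp⟩⟩
      · refine (totalDegree_mul _ _).trans ?_
        rw [totalDegree_C, zero_add]
        exact (totalDegree_sub_C_le _ _).trans (totalDegree_X i).le
      · simp [inv_mul_cancel₀ (sub_ne_zero.2 hi)]
  choose q hq1 hq using hsep
  refine ⟨∑ z ∈ Z, C (g z) * ∏ w ∈ Z.erase z, q z w, ?_, fun z hz => ?_⟩
  · refine totalDegree_finsetSum_le fun z _ => (totalDegree_mul _ _).trans ?_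
    rw [totalDegree_C, zero_add]
    refine (totalDegree_finsetProd _ _).trans ?_
    refine (Finset.sum_le_card_nsmul _ _ 1 fun w _ => hq1 z w).trans ?_
    simpa using Finset.card_le_card (Finset.erase_subset z Z)
  · rw [map_sum, Finset.sum_eq_single z]
    · rw [map_mul, eval_C, map_prod, Finset.prod_eq_one, mul_one]
      exact fun w hw => (hq z w (Finset.ne_of_mem_erase hw).symm).1
    · intro y _ hyz
      rw [map_mul, map_prod, Finset.prod_eq_zero (Finset.mem_erase.2 ⟨hyz.symm, hz⟩)
        (hq y z hyz).2, mul_zero]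
    · exact fun h => (h hz).elim

open Classical in
/-- The linear map sending a monomial `x ^ a` with some `D i ≤ a i` to `x ^ (a - D i eᵢ) * f i`
for one such `i`, and all other monomials to `0`. -/
noncomputable def leadingReduction {ι K : Type*} [Field K] (f : ι → MvPolynomial ι K)
    (D : ι → ℕ) : MvPolynomial ι K →ₗ[K] MvPolynomial ι K :=
  (basisMonomials ι K).constr K fun a =>
    if h : ∃ i, D i ≤ a i then
      monomial (a - Finsupp.single h.choose (D h.choose)) 1 * f h.choose
    else 0

theorem leadingReduction_monomial_of_exists {ι K : Type*} [Field K] (f : ι → MvPolynomial ι K)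
    (D : ι → ℕ) {a : ι →₀ ℕ} (h : ∃ i, D i ≤ a i) :
    ∃ i, D i ≤ a i ∧ leadingReduction f D (monomial a 1) =
      monomial (a - Finsupp.single i (D i)) 1 * f i := by
  refine ⟨h.choose, h.choose_spec, ?_⟩
  have hb : monomial a (1 : K) = basisMonomials ι K a := by simp
  rw [leadingReduction, hb, Module.Basis.constr_basis, dif_pos h]

theorem leadingReduction_monomial_of_forall {ι K : Type*} [Field K] (f : ι → MvPolynomial ι K)
    (D : ι → ℕ) {a : ι →₀ ℕ} (h : ∀ i, a i < D i) :
    leadingReduction f D (monomial a 1) = 0 := by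
  have hb : monomial a (1 : K) = basisMonomials ι K a := by simp
  rw [leadingReduction, hb, Module.Basis.constr_basis,
    dif_neg (by simpa using h)]

theorem leadingReduction_mem {ι K : Type*} [Field K] (f : ι → MvPolynomial ι K)
    {D : ι → ℕ} (hf : ∀ i, (f i).totalDegree ≤ D i) (m : ℕ) {p : MvPolynomial ι K}
    (hp : p ∈ restrictTotalDegree ι K m) :
    leadingReduction f D p ∈ restrictTotalDegree ι K m := by
  classical
  rw [p.as_sum, map_sum]
  refine Submodule.sum_mem _ fun a ha => ?_
  rw [← mul_one (coeff a p), ← smul_eq_mul, ← smul_monomial, map_smul]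
  refine Submodule.smul_mem _ _ ?_
  have ham : (a.sum fun _ e => e) ≤ m :=
    (le_totalDegree ha).trans ((mem_restrictTotalDegree _ _ _).1 hp)
  by_cases h : ∃ i, D i ≤ a i
  · obtain ⟨i, hi, he⟩ := leadingReduction_monomial_of_exists f D h
    rw [he, mem_restrictTotalDegree]
    refine (totalDegree_mul _ _).trans ?_
    have hle : Finsupp.single i (D i) ≤ a := Finsupp.single_le_iff.2 hi
    have hsum : (a - Finsupp.single i (D i)).sum (fun _ e => e) + D i = a.sum fun _ e => e := by
      conv_rhs => rw [← tsub_add_cancel_of_le hle]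
      rw [Finsupp.sum_add_index' (by simp) (by simp), Finsupp.sum_single_index rfl]
    have h1 := totalDegree_monomial_le (R := K) (a - Finsupp.single i (D i)) 1
    have h2 := hf i
    change _ ≤ (a - Finsupp.single i (D i)).sum fun _ e => e at h1
    omega
  · rw [leadingReduction_monomial_of_forall f D (by simpa using h)]
    exact Submodule.zero_mem _

/-- For all but finitely many `t`, the system `f i + t * X i ^ D i = 0`, where `f i` has degree at
most `D i`, has at most `∏ i, D i` solutions in every set of at most `m` points. -/
theorem finite_setOf_not_card_le_prod {ι K : Type*} [Fintype ι] [Field K]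
    (f : ι → MvPolynomial ι K) {D : ι → ℕ} (hf : ∀ i, (f i).totalDegree ≤ D i) (m : ℕ) :
    {t : K | ¬ ∀ Z : Finset (ι → K), Z.card ≤ m →
      (∀ z ∈ Z, ∀ i, eval z (f i) + t * z i ^ D i = 0) → Z.card ≤ ∏ i, D i}.Finite := by
  classical
  set W := restrictTotalDegree ι K m
  set B : Module.End K W := (leadingReduction f D).restrict fun p hp =>
    leadingReduction_mem f hf m hp
  refine (Module.End.finite_spectrum (-B)).subset fun t hbad => by_contra fun ht => hbad ?_
  intro Z hZm hZ
  have hneg : algebraMap K (Module.End K W) t - -B = algebraMap K (Module.End K W) t + B :=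
    LinearMap.ext fun _ => sub_neg_eq_add _ _
  rw [spectrum.notMem_iff, hneg, Module.End.isUnit_iff] at ht
  let ev : MvPolynomial ι K →ₗ[K] (Z → K) :=
    LinearMap.pi fun z => (aeval (z : ι → K)).toLinearMap
  have hev : ∀ p z, ev p z = eval (z : ι → K) p := fun p z => by simp [ev, aeval_eq_eval]
  let A : Finset (ι → ℕ) := Fintype.piFinset fun i => Finset.range (D i)
  let e : (ι → ℕ) → (Z → K) := fun a => ev (monomial (Finsupp.equivFunOnFinite.symm a) 1)
  let L : MvPolynomial ι K →ₗ[K] (Z → K) := ev ∘ₗ (t • LinearMap.id + leadingReduction f D)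
  have hmon : ∀ a, L (monomial a 1) ∈ Submodule.span K (A.image e : Set (Z → K)) := by
    intro a
    by_cases h : ∃ i, D i ≤ a i
    · obtain ⟨i, hi, he⟩ := leadingReduction_monomial_of_exists f D h
      convert Submodule.zero_mem _
      ext z
      have hle : Finsupp.single i (D i) ≤ a := Finsupp.single_le_iff.2 hi
      have hsplit : monomial a (1 : K) =
          monomial (a - Finsupp.single i (D i)) 1 * X i ^ D i := by
        rw [X_pow_eq_monomial, monomial_mul, tsub_add_cancel_of_le hle, one_mul]
      simp only [L, LinearMap.comp_apply, LinearMap.add_apply, LinearMap.smul_apply,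
        LinearMap.id_apply, he, hev, Pi.zero_apply]
      rw [hsplit, smul_eq_C_mul]
      simp only [map_add, map_mul, map_pow, eval_C, eval_X]
      linear_combination eval (z : ι → K) (monomial (a - Finsupp.single i (D i)) 1) * hZ z z.2 i
    · have h' : ∀ i, a i < D i := by simpa using h
      have hL : L (monomial a 1) = t • e a := by
        simp only [L, LinearMap.comp_apply, LinearMap.add_apply, LinearMap.smul_apply,
          LinearMap.id_apply, leadingReduction_monomial_of_forall f D h', add_zero, map_smul, e]
        congr 3
        ext; simp
      rw [hL]
      refine Submodule.smul_mem _ _ (Submodule.subset_span ?_)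
      exact Finset.mem_coe.2 (Finset.mem_image_of_mem e (by simpa [A] using h'))
  have hrange : ∀ p, L p ∈ Submodule.span K (A.image e : Set (Z → K)) := by
    intro p
    rw [p.as_sum, map_sum]
    refine Submodule.sum_mem _ fun a _ => ?_
    rw [← mul_one (coeff a p), ← smul_eq_mul, ← smul_monomial, map_smul]
    exact Submodule.smul_mem _ _ (hmon a)
  have htop : Submodule.span K (A.image e : Set (Z → K)) = ⊤ := by
    rw [eq_top_iff]
    rintro g -
    obtain ⟨p, hp, hpg⟩ := exists_eval_eq_on_finset Z fun z => if h : z ∈ Z then g ⟨z, h⟩ else 0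
    obtain ⟨r, hr⟩ := ht.2 ⟨p, (mem_restrictTotalDegree _ _ _).2 (hp.trans hZm)⟩
    have hr' : t • (r : MvPolynomial ι K) + leadingReduction f D r = p := by
      simpa [B] using congrArg Subtype.val hr
    have : g = L r := by
      ext z
      simp [L, hr', hev, hpg z z.2, -map_add, -map_smul]
    rw [this]
    exact hrange _
  have h1 := finrank_span_finset_le_card (R := K) (A.image e)
  rw [Set.finrank, htop, finrank_top, Module.finrank_fintype_fun_eq_card, Fintype.card_coe] at h1
  refine (h1.trans Finset.card_image_le).trans ?_
  simp [A]

/-- A nondegenerate common zero of the `f i` persists in the system `f i + t * g i = 0` for all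
small `t`. -/
theorem eventually_exists_zero_add_mul {ι : Type*} [Fintype ι] (f g : ι → MvPolynomial ι ℝ)
    {z : ι → ℝ} (hz : ∀ i, eval z (f i) = 0)
    (hnd : ∀ ξ : ι → ℝ, (∀ i, ∑ j, eval z (pderiv j (f i)) * ξ j = 0) → ξ = 0)
    {U : Set (ι → ℝ)} (hU : U ∈ nhds z) :
    ∀ᶠ t : ℝ in nhds 0, ∃ x ∈ U, ∀ i, eval x (f i) + t * eval x (g i) = 0 := by
  let Ψ : ℝ × (ι → ℝ) → ℝ × (ι → ℝ) := fun q =>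
    (q.1, fun i => eval q.2 (f i) + q.1 * eval q.2 (g i))
  let Ψ' : ℝ × (ι → ℝ) →L[ℝ] ℝ × (ι → ℝ) :=
    (ContinuousLinearMap.fst ℝ ℝ (ι → ℝ)).prod (ContinuousLinearMap.pi fun i =>
      (evalDifferential (f i) z).comp (ContinuousLinearMap.snd ℝ ℝ (ι → ℝ)) +
        ((0 : ℝ) • (evalDifferential (g i) z).comp (ContinuousLinearMap.snd ℝ ℝ (ι → ℝ)) +
          eval z (g i) • ContinuousLinearMap.fst ℝ ℝ (ι → ℝ)))
  have hΨ : HasStrictFDerivAt Ψ Ψ' (0, z) := by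
    refine hasStrictFDerivAt_fst.prodMk (hasStrictFDerivAt_pi.2 fun i => ?_)
    have hs : HasStrictFDerivAt (Prod.snd : ℝ × (ι → ℝ) → (ι → ℝ))
      (ContinuousLinearMap.snd ℝ ℝ (ι → ℝ)) (0, z) := hasStrictFDerivAt_snd
    have hfi := (hasStrictFDerivAt_eval (f i) z).comp (0, z) hs
    have hgi := (hasStrictFDerivAt_eval (g i) z).comp (0, z) hs
    exact hfi.add (hasStrictFDerivAt_fst.mul hgi)
  have hinj : Function.Injective Ψ' := by
    rw [injective_iff_map_eq_zero]
    rintro ⟨τ, ξ⟩ h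
    obtain ⟨h1, h2⟩ := Prod.ext_iff.1 h
    have hτ : τ = 0 := h1
    subst hτ
    refine Prod.ext rfl (hnd ξ fun i => ?_)
    simpa [Ψ'] using congrFun h2 i
  have hsurj : Ψ'.range = ⊤ :=
    LinearMap.range_eq_top.2 (LinearMap.injective_iff_surjective.1 hinj)
  have hmap := hΨ.map_nhds_eq_of_surj hsurj
  have hΨ0 : Ψ (0, z) = (0, 0) := by
    refine Prod.ext rfl ?_
    funext i
    simp [Ψ, hz i]
  have himg : Ψ '' (Set.univ ×ˢ U) ∈ nhds ((0 : ℝ), (0 : ι → ℝ)) := by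
    rw [← hΨ0, ← hmap]
    exact Filter.image_mem_map (prod_mem_nhds Filter.univ_mem hU)
  have hcont : Filter.Tendsto (fun t : ℝ => (t, (0 : ι → ℝ))) (nhds 0) (nhds (0, 0)) :=
    (by fun_prop : Continuous fun t : ℝ => (t, (0 : ι → ℝ))).tendsto 0
  filter_upwards [hcont himg] with t ht
  obtain ⟨⟨τ, x⟩, ⟨-, hx⟩, heq⟩ := ht
  obtain ⟨h1, h2⟩ := Prod.ext_iff.1 heq
  have hτ : τ = t := h1
  subst hτ
  exact ⟨x, hx, fun i => congrFun h2 i⟩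

/-- Bézout's bound for nondegenerate real zeros. -/
theorem card_le_prod_of_nondegenerate_zeros {ι : Type*} [Fintype ι] (f : ι → MvPolynomial ι ℝ)
    {D : ι → ℕ} (hf : ∀ i, (f i).totalDegree ≤ D i) (Z : Finset (ι → ℝ))
    (hZ : ∀ z ∈ Z, ∀ i, eval z (f i) = 0)
    (hnd : ∀ z ∈ Z, ∀ ξ : ι → ℝ, (∀ i, ∑ j, eval z (pderiv j (f i)) * ξ j = 0) → ξ = 0) :
    Z.card ≤ ∏ i, D i := by
  classical
  obtain ⟨U, hU, hdisj⟩ := Z.finite_toSet.t2_separation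
  have hpersist : ∀ᶠ t : ℝ in nhds 0, ∀ z ∈ Z, ∃ x ∈ U z, ∀ i,
      eval x (f i) + t * eval x (X i ^ D i : MvPolynomial ι ℝ) = 0 :=
    (Finset.eventually_all Z).2 fun z hz => eventually_exists_zero_add_mul f _ (hZ z hz)
      (hnd z hz) ((hU z).2.mem_nhds (hU z).1)
  obtain ⟨t, hbound, ht⟩ := (infinite_of_mem_nhds 0 hpersist).exists_notMem_finite
    (finite_setOf_not_card_le_prod f hf Z.card) |>.imp fun _ h => h.symm
  choose! x hxU hx using ht
  have hinj : Set.InjOn x Z := fun z hz w hw h => by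
    by_contra hne
    exact Set.disjoint_left.1 (hdisj hz hw hne) (hxU z hz) (h ▸ hxU w hw)
  have hcard : (Z.image x).card = Z.card := Finset.card_image_of_injOn hinj
  rw [← hcard]
  refine (not_not.1 hbound) _ hcard.le ?_
  intro y hy i
  obtain ⟨z, hz, rfl⟩ := Finset.mem_image.1 hy
  simpa using hx z hz i

end MvPolynomial

/-- A finite set of nondegenerate critical points of `p` on a coordinate plane has at most
`(deg p - 1) ^ #S` elements. -/
theorem card_le_of_subset_critOnPlane {n : ℕ} (p : MvPolynomial (Fin n) ℝ) (S : Finset (Fin n))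
    (v : Fin n → ℝ) (hnondeg : ∀ x ∈ critOnPlane p S v, (hessOnPlane p S x).det ≠ 0)
    (Z : Finset (Fin n → ℝ)) (hZ : (Z : Set (Fin n → ℝ)) ⊆ critOnPlane p S v) :
    Z.card ≤ (p.totalDegree - 1) ^ S.card := by
  classical
  let f : Fin n → MvPolynomial (Fin n) ℝ := fun j =>
    if j ∈ S then pderiv j p else X j - C (v j)
  have hprod : ∏ j, (if j ∈ S then p.totalDegree - 1 else 1) = (p.totalDegree - 1) ^ S.card := by
    simp [Finset.prod_ite_mem]
  rw [← hprod]
  refine card_le_prod_of_nondegenerate_zeros f (fun j => ?_) Z (fun z hz j => ?_)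
    fun z hz ξ hξ => ?_
  · by_cases hj : j ∈ S
    · simpa [f, hj] using totalDegree_pderiv_le p j
    · simpa [f, hj] using (totalDegree_sub_C_le _ _).trans (totalDegree_X (R := ℝ) j).le
  · by_cases hj : j ∈ S
    · simpa [f, hj] using (hZ hz).2 j hj
    · simpa [f, hj, sub_eq_zero] using (hZ hz).1 j hj
  · have hout : ∀ j ∉ S, ξ j = 0 := fun j hj => by
      simpa [f, hj, pderiv_X, Pi.single_apply, apply_ite] using hξ j
    have hker : (hessOnPlane p S z).mulVec (fun j => ξ j) = 0 := by
      funext j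
      have h := hξ j
      rw [← Finset.sum_subset (Finset.subset_univ S) fun l _ hl => by rw [hout l hl, mul_zero],
        ← Finset.sum_coe_sort] at h
      simpa [f, hessOnPlane, Matrix.mulVec, dotProduct] using h
    have hzero := Matrix.eq_zero_of_mulVec_eq_zero (hnondeg z (hZ hz)) hker
    funext j
    by_cases hj : j ∈ S
    · exact congrFun hzero ⟨j, hj⟩
    · exact hout j hj

/-- If a partial derivative of `p` at `x` does not vanish, `p` decreases strictly along a short
coordinate segment issuing from `x`. -/
theorem exists_segment_eval_lt {ι : Type*} [Fintype ι] [DecidableEq ι] (p : MvPolynomial ι ℝ)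
    (x : ι → ℝ) {j : ι} (h : eval x (pderiv j p) ≠ 0) :
    ∃ c δ : ℝ, 0 < δ ∧ ∀ t ∈ Set.Ioc 0 δ, eval (x + t • Pi.single j c) p < eval x p := by
  set a := eval x (pderiv j p) with ha
  have hline : HasDerivAt (fun t : ℝ => x + t • Pi.single (M := fun _ : ι => ℝ) j (-a))
      (Pi.single j (-a)) 0 := by
    simpa using ((hasDerivAt_id (0 : ℝ)).smul_const
      (Pi.single (M := fun _ : ι => ℝ) j (-a))).const_add x
  have hp := (hasStrictFDerivAt_eval p x).hasFDerivAt
  have hx : x = x + (0 : ℝ) • Pi.single (M := fun _ : ι => ℝ) j (-a) := by simp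
  have hd := HasFDerivAt.comp_hasDerivAt (0 : ℝ) (by rwa [← hx]) hline
  have hval : evalDifferential p x (Pi.single j (-a)) < 0 := by
    simp only [evalDifferential_apply, Pi.single_apply, mul_ite, mul_zero, Finset.sum_ite_eq',
      Finset.mem_univ, if_true, ← ha]
    nlinarith [mul_self_pos.2 h]
  have hslope := (hasDerivAt_iff_tendsto_slope.1 hd).eventually_lt_const hval
  have hright := hslope.filter_mono (nhdsWithin_mono 0 fun t (ht : 0 < t) => ht.ne')
  obtain ⟨δ, hδ, hsub⟩ := mem_nhdsGT_iff_exists_Ioc_subset.1 hright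
  refine ⟨-a, δ, hδ, fun t ht => ?_⟩
  have hneg : slope (fun t : ℝ => eval (x + t • Pi.single j (-a)) p) (0 : ℝ) t < 0 := hsub ht
  rw [slope_def_field, div_neg_iff] at hneg
  have ht0 := ht.1
  rcases hneg with hneg | hneg
  · linarith [hneg.2]
  · simpa using hneg.1

/-- Every compact connected component of a sublevel set of `p` on a coordinate plane contains a
critical point of the restriction of `p`. -/
theorem exists_mem_critOnPlane_of_isCompact {n : ℕ} (p : MvPolynomial (Fin n) ℝ)
    (S : Finset (Fin n)) (v : Fin n → ℝ) (ρ : ℝ) {x : Fin n → ℝ}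
    (hx : x ∈ {y | y ∈ coordPlane S v ∧ eval y p ≤ ρ})
    (hT : IsCompact (connectedComponentIn {y | y ∈ coordPlane S v ∧ eval y p ≤ ρ} x)) :
    ∃ z ∈ connectedComponentIn {y | y ∈ coordPlane S v ∧ eval y p ≤ ρ} x,
      z ∈ critOnPlane p S v := by
  set F := {y | y ∈ coordPlane S v ∧ eval y p ≤ ρ}
  obtain ⟨z, hz, hmin⟩ := hT.exists_isMinOn ⟨x, mem_connectedComponentIn hx⟩
    (MvPolynomial.continuous_eval p).continuousOn
  have hzF : z ∈ F := connectedComponentIn_subset F x hz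
  refine ⟨z, hz, hzF.1, fun j hj => by_contra fun hne => ?_⟩
  obtain ⟨c, δ, hδ, hlt⟩ := exists_segment_eval_lt p z hne
  let γ : ℝ → Fin n → ℝ := fun t => z + t • Pi.single j c
  have hγ : Continuous γ := by fun_prop
  have hpre : IsPreconnected (γ '' Set.Icc 0 δ) := isPreconnected_Icc.image _ hγ.continuousOn
  have hzγ : z ∈ γ '' Set.Icc 0 δ := ⟨0, ⟨le_rfl, hδ.le⟩, by simp [γ]⟩
  have hsub : γ '' Set.Icc 0 δ ⊆ F := by
    rintro _ ⟨t, ⟨ht0, htδ⟩, rfl⟩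
    refine ⟨fun l hl => ?_, ?_⟩
    · have hlj : l ≠ j := fun h => hl (h ▸ hj)
      simpa [γ, hlj] using hzF.1 l hl
    · rcases ht0.eq_or_lt with rfl | ht0
      · simpa [γ] using hzF.2
      · exact (hlt t ⟨ht0, htδ⟩).le.trans hzF.2
  have hmem : γ δ ∈ connectedComponentIn F x := by
    rw [connectedComponentIn_eq hz]
    exact hpre.subset_connectedComponentIn hzγ hsub ⟨δ, ⟨hδ.le, le_rfl⟩, rfl⟩
  exact (hlt δ ⟨hδ, le_rfl⟩).not_ge (hmin hmem)

theorem stmt3 {n s d : ℕ} (p : MvPolynomial (Fin n) ℝ) (hd : p.totalDegree = d)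
    (hd1 : 1 ≤ d) (ρ : ℝ) (S : Finset (Fin n)) (hS : S.card = s) (hs1 : 1 ≤ s) (hsn : s ≤ n)
    (v : Fin n → ℝ)
    (hnondeg : ∀ x ∈ critOnPlane p S v, (hessOnPlane p S x).det ≠ 0) :
    ((critOnPlane p S v).Finite ∧ (critOnPlane p S v).ncard ≤ (d - 1) ^ s) ∧
    ({T | ∃ x ∈ {y | y ∈ coordPlane S v ∧ eval y p ≤ ρ},
        T = connectedComponentIn {y | y ∈ coordPlane S v ∧ eval y p ≤ ρ} x ∧
        IsCompact T}.Finite ∧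
      {T | ∃ x ∈ {y | y ∈ coordPlane S v ∧ eval y p ≤ ρ},
        T = connectedComponentIn {y | y ∈ coordPlane S v ∧ eval y p ≤ ρ} x ∧
        IsCompact T}.ncard ≤ (d - 1) ^ s) := by
  classical
  subst hd hS
  have hbound := card_le_of_subset_critOnPlane p S v hnondeg
  have hfin : (critOnPlane p S v).Finite := by
    by_contra hinf
    obtain ⟨Z, hZ, hcard⟩ :=
      Set.Infinite.exists_subset_card_eq hinf ((p.totalDegree - 1) ^ S.card + 1)
    have := hbound Z hZ
    omega
  have hncard : (critOnPlane p S v).ncard ≤ (p.totalDegree - 1) ^ S.card := by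
    rw [Set.ncard_eq_toFinset_card _ hfin]
    exact hbound _ (by simp)
  refine ⟨⟨hfin, hncard⟩, ?_⟩
  set F := {y | y ∈ coordPlane S v ∧ eval y p ≤ ρ}
  have hsub : {T | ∃ x ∈ F, T = connectedComponentIn F x ∧ IsCompact T} ⊆
      connectedComponentIn F '' critOnPlane p S v := by
    rintro T ⟨x, hx, rfl, hT⟩
    obtain ⟨z, hz, hzc⟩ := exists_mem_critOnPlane_of_isCompact p S v ρ hx hT
    exact ⟨z, hzc, (connectedComponentIn_eq hz).symm⟩
  exact ⟨(hfin.image _).subset hsub, (Set.ncard_le_ncard hsub (hfin.image _)).trans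
    ((Set.ncard_image_le hfin).trans hncard)⟩
end

section
/- Let p be a real polynomial in n variables of multi-degree d, i.e., each variable x_i appears in p with degree at most d. Fix indices j_1 < ⋯ < j_s in {1,…,n} and nonzero real values c_j for the remaining indices. Then the number of non-degenerate real solutions, with all coordinates nonzero, of the system ∂p/∂x_{j_1} = ⋯ = ∂p/∂x_{j_s} = 0 restricted to the plane {x : x_j = c_j for all j ∉ {j_1,…,j_s}} is at most s!·d^s. -/
open MvPolynomial

/-- The point of the plane `{x : x_j = c_j for j ∉ S}` with free coordinates `y`. -/
noncomputable def planePt {n : ℕ} (S : Finset (Fin n)) (c : Fin n → ℝ)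
    (y : {j // j ∈ S} → ℝ) : Fin n → ℝ :=
  fun j => if h : j ∈ S then y ⟨j, h⟩ else c j

section Substitution

variable {R σ τ : Type*} [CommSemiring R]

theorem degreeOf_aeval_le {f : σ → MvPolynomial τ R} {g : MvPolynomial σ R} {i : τ} {D : ℕ}
    (h : ∀ m ∈ g.support, (m.sum fun j e => e * (f j).degreeOf i) ≤ D) :
    (aeval f g).degreeOf i ≤ D := by
  rw [aeval_def, eval₂_eq]
  refine (degreeOf_sum_le _ _ _).trans (Finset.sup_le fun m hm => ?_)
  refine (degreeOf_C_mul_le _ _ _).trans ((degreeOf_prod_le _ _ _).trans ?_)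
  exact (Finset.sum_le_sum fun j _ => degreeOf_pow_le _ _ _).trans (h m hm)

theorem degreeOf_pderiv_le (i j : σ) (g : MvPolynomial σ R) :
    (pderiv j g).degreeOf i ≤ g.degreeOf i := by
  classical
  conv_lhs => rw [g.as_sum, map_sum]
  refine (degreeOf_sum_le _ _ _).trans (Finset.sup_le fun m hm => ?_)
  rw [pderiv_monomial, degreeOf_le_iff]
  intro m' hm'
  have : m' = m - Finsupp.single j 1 := by
    simpa using Finset.mem_of_subset support_monomial_subset hm'
  rw [this]
  exact (tsub_le_self (a := m i)).trans (degreeOf_le_iff.mp le_rfl m hm)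

end Substitution

section Line

variable {K ι : Type*} [CommRing K]

/-- Restriction of a polynomial to the parametrized line `t ↦ ξ + t v`. -/
noncomputable def restrictLine (ξ v : ι → K) : MvPolynomial ι K →ₐ[K] Polynomial K :=
  aeval fun l => Polynomial.C (ξ l) + Polynomial.X * Polynomial.C (v l)

theorem eval_zero_restrictLine (ξ v : ι → K) (g : MvPolynomial ι K) :
    (restrictLine ξ v g).eval 0 = eval ξ g := by
  induction g using MvPolynomial.induction_on with
  | C a => simp [restrictLine]
  | add p q hp hq => simp [hp, hq]
  | mul_X p l hp => simp [hp]; simp [restrictLine]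

theorem derivative_restrictLine [Fintype ι] (ξ v : ι → K) (g : MvPolynomial ι K) :
    Polynomial.derivative (restrictLine ξ v g) =
      ∑ l, Polynomial.C (v l) * restrictLine ξ v (pderiv l g) := by
  classical
  induction g using MvPolynomial.induction_on with
  | C a => simp [restrictLine]
  | add p q hp hq => simp [hp, hq, mul_add, Finset.sum_add_distrib]
  | mul_X p l hp =>
    have hX : Polynomial.derivative (restrictLine ξ v (X l)) = Polynomial.C (v l) := by
      simp [restrictLine]
    simp only [map_mul, Polynomial.derivative_mul, hp, hX, Derivation.leibniz, smul_eq_mul,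
      map_add, mul_add, Finset.sum_add_distrib, pderiv_X, Pi.single_apply]
    rw [Finset.sum_mul, add_comm]
    congr 1
    · simp [mul_comm]
    · exact Finset.sum_congr rfl fun _ _ => by ring

/-- Along a line through a common zero `ξ`, each polynomial is divisible by the parameter, and the
quotient at the origin is the directional derivative. -/
theorem exists_restrictLine_eq_X_mul [Fintype ι] (ξ v : ι → K) {g : MvPolynomial ι K}
    (hg : eval ξ g = 0) :
    ∃ h : Polynomial K, restrictLine ξ v g = Polynomial.X * h ∧
      h.eval 0 = ∑ l, eval ξ (pderiv l g) * v l := by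
  obtain ⟨h, hh⟩ : Polynomial.X ∣ restrictLine ξ v g := by
    rw [Polynomial.X_dvd_iff, Polynomial.coeff_zero_eq_eval_zero, eval_zero_restrictLine, hg]
  refine ⟨h, hh, ?_⟩
  have := congrArg (Polynomial.eval 0) (derivative_restrictLine ξ v g)
  rw [hh] at this
  simpa [Polynomial.eval_finsetSum, eval_zero_restrictLine, mul_comm] using this

theorem MvPolynomial.IsHomogeneous.aeval_mul_left {σ A : Type*} [CommRing A] [Algebra K A]
    {g : MvPolynomial σ K} {m : ℕ} (hg : g.IsHomogeneous m) (a : A) (h : σ → A) :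
    MvPolynomial.aeval (fun j => a * h j) g = a ^ m * MvPolynomial.aeval h g := by
  rw [aeval_def, aeval_def, eval₂_eq, eval₂_eq, Finset.mul_sum]
  refine Finset.sum_congr rfl fun s hs => ?_
  have : s.degree = m := by
    rw [Finsupp.degree_eq_weight_one]
    exact hg (mem_support_iff.mp hs)
  simp only [mul_pow, Finset.prod_mul_distrib, Finset.prod_pow_eq_pow_sum]
  rw [show ∑ i ∈ s.support, s i = m from this]
  ring

/-- If the homogeneous components of `g` of degree below `m` vanish, then substituting multiples
of `X` gives `X ^ m` times the substitution in the component of degree `m`, up to higher order. -/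
theorem exists_aeval_X_mul_eq {σ : Type*} {g : MvPolynomial σ K} {m : ℕ}
    (hg : ∀ k < m, homogeneousComponent k g = 0) (h : σ → Polynomial K) :
    ∃ r : Polynomial K, aeval (fun j => Polynomial.X * h j) g =
      Polynomial.X ^ m * (aeval h (homogeneousComponent m g) + Polynomial.X * r) := by
  have hsum : ∑ k ∈ Finset.range (g.totalDegree + 1 + m + 1), homogeneousComponent k g = g := by
    rw [add_assoc, Finset.sum_range_add, sum_homogeneousComponent, add_eq_left]
    exact Finset.sum_eq_zero fun k _ => homogeneousComponent_eq_zero _ _ (by omega)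
  rw [show g.totalDegree + 1 + m + 1 = m + (1 + (g.totalDegree + 1)) by ring,
    Finset.sum_range_add, Finset.sum_eq_zero fun k hk => hg k (Finset.mem_range.mp hk), zero_add,
    Finset.sum_range_add] at hsum
  refine ⟨∑ k ∈ Finset.range (g.totalDegree + 1),
    Polynomial.X ^ k * aeval h (homogeneousComponent (m + (1 + k)) g), ?_⟩
  conv_lhs => rw [← hsum]
  simp only [map_add, map_sum, Finset.sum_range_one, add_zero,
    (homogeneousComponent_isHomogeneous _ g).aeval_mul_left, mul_add, Finset.mul_sum]
  exact congrArg _ (Finset.sum_congr rfl fun k _ => by ring)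

end Line

section Independence

variable {K ι : Type*} [Field K]

/-- Functions separating the points of a set of non-degenerate common zeros of a square system `f`
are linearly independent over the polynomials in `f`. -/
theorem eq_zero_of_sum_mul_aeval_eq_zero [Infinite K] [Fintype ι] [DecidableEq ι]
    (f : ι → MvPolynomial ι K) (T : Finset (ι → K))
    (hf : ∀ ξ ∈ T, ∀ j, eval ξ (f j) = 0)
    (hJ : ∀ ξ ∈ T, (Matrix.of fun j l => eval ξ (pderiv l (f j))).det ≠ 0)
    (a : T → MvPolynomial ι K) (ha : ∀ i : T, eval i (a i) ≠ 0)
    (ha' : ∀ i j : T, i ≠ j → eval j (a i) = 0)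
    (g : T → MvPolynomial ι K) (hg : ∑ i, a i * aeval f (g i) = 0) (i : T) : g i = 0 := by
  have key : ∀ m, ∀ i, homogeneousComponent m (g i) = 0 := by
    intro m
    induction m using Nat.strong_induction_on with
    | _ m ih =>
      intro i
      refine (homogeneousComponent_isHomogeneous m (g i)).eq_zero_of_forall_eval_eq_zero
        fun w => ?_
      set J : Matrix ι ι K := Matrix.of fun j l => eval (i : ι → K) (pderiv l (f j))
      have hunit : IsUnit J.det := (hJ i i.2).isUnit
      set v : ι → K := J⁻¹.mulVec w
      have hv : J.mulVec v = w := by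
        rw [Matrix.mulVec_mulVec, Matrix.mul_nonsing_inv _ hunit, Matrix.one_mulVec]
      choose h hh hh0 using fun j => exists_restrictLine_eq_X_mul (i : ι → K) v (hf i i.2 j)
      have hh0' : ∀ j, (h j).eval 0 = w j := fun j => by
        rw [hh0, ← hv]; rfl
      choose r hr using fun k => exists_aeval_X_mul_eq (fun n hn => ih n hn k) h
      have hline : ∀ k, restrictLine (i : ι → K) v (aeval f (g k)) =
          aeval (fun j => Polynomial.X * h j) (g k) := fun k => by
        rw [comp_aeval_apply]; simp only [hh]
      have h0 := congrArg (restrictLine (i : ι → K) v) hg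
      simp only [map_sum, map_mul, hline, hr, map_zero] at h0
      simp only [mul_left_comm _ (Polynomial.X ^ m), ← Finset.mul_sum] at h0
      have h1 := (mul_eq_zero.mp h0).resolve_left (pow_ne_zero _ Polynomial.X_ne_zero)
      have h2 := congrArg (Polynomial.eval 0) h1
      simp only [Polynomial.eval_finsetSum, Polynomial.eval_mul, Polynomial.eval_add,
        Polynomial.eval_X, zero_mul, add_zero, eval_zero_restrictLine, Polynomial.eval_zero] at h2
      rw [Finset.sum_eq_single i (fun k _ hk => by rw [ha' k i hk, zero_mul])
        (fun hi => (hi (Finset.mem_univ i)).elim)] at h2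
      have h3 := (mul_eq_zero.mp h2).resolve_left (ha i)
      rw [← h3, ← Polynomial.coe_evalRingHom, aeval_def, eval₂_comp_left]
      simp only [eval, coe_eval₂Hom]
      congr 1
      · ext; simp
      · ext j; simp [hh0']
  rw [← sum_homogeneousComponent (g i)]
  exact Finset.sum_eq_zero fun m _ => key m i

/-- Finitely many points admit polynomials vanishing at all of them but one. -/
theorem exists_separating (T : Finset (ι → K)) :
    ∃ a : T → MvPolynomial ι K, (∀ i : T, eval i (a i) ≠ 0) ∧
      ∀ i j : T, i ≠ j → eval j (a i) = 0 := by
  classical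
  have hl : ∀ i j : T, ∃ q : MvPolynomial ι K, eval j q = 0 ∧ (i ≠ j → eval i q ≠ 0) := by
    intro i j
    by_cases hij : i = j
    · exact ⟨0, by simp, fun h => (h hij).elim⟩
    · obtain ⟨l, hl⟩ := Function.ne_iff.mp fun h => hij (Subtype.ext h)
      exact ⟨X l - C ((j : ι → K) l), by simp, fun _ => by simpa [sub_eq_zero] using hl⟩
  choose q hq hq' using hl
  refine ⟨fun i => ∏ j ∈ Finset.univ.erase i, q i j, fun i => ?_, fun i j hij => ?_⟩
  · rw [eval_prod, Finset.prod_ne_zero_iff]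
    exact fun j hj => hq' i j (Finset.ne_of_mem_erase hj).symm
  · rw [eval_prod]
    exact Finset.prod_eq_zero (Finset.mem_erase.mpr ⟨hij.symm, Finset.mem_univ j⟩) (hq i j)

end Independence

section Dimension

variable (K ι : Type*) [Field K] [Fintype ι]

theorem finrank_restrictDegree_le (M : ℕ) :
    Module.finrank K (restrictDegree ι K M) ≤ (M + 1) ^ Fintype.card ι := by
  classical
  let e : {n : ι →₀ ℕ | ∀ i, n i ≤ M} → ι → Fin (M + 1) := fun n i => ⟨n.1 i, by
    have := n.2 i; omega⟩
  have he : Function.Injective e := fun n n' h => Subtype.ext <| Finsupp.ext fun i => by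
    simpa [e] using congrFun h i
  rw [restrictDegree, Module.finrank_eq_nat_card_basis (basisRestrictSupport K _)]
  simpa using Nat.card_le_card_of_injective e he

theorem choose_le_finrank_restrictTotalDegree (k : ℕ) :
    (k + Fintype.card ι).choose (Fintype.card ι) ≤
      Module.finrank K (restrictTotalDegree ι K k) := by
  classical
  have hmem : ∀ n : (Finset.univ : Finset (Option ι)).finsuppAntidiag k,
      n.1 none + ∑ i, n.1 (some i) = k := fun n => by
    have := (Finset.mem_finsuppAntidiag.mp n.2).1
    rwa [Fintype.sum_option] at this
  let e : (Finset.univ : Finset (Option ι)).finsuppAntidiag k →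
      {n : ι →₀ ℕ | (n.sum fun _ e => e) ≤ k} := fun n => ⟨n.1.some, by
    have := hmem n
    rw [Set.mem_ofPred_eq, Finsupp.sum_fintype _ _ fun _ => rfl]
    simp only [Finsupp.some_apply]
    omega⟩
  have he : Function.Injective e := fun n n' h => by
    have hs : ∀ i, n.1 (some i) = n'.1 (some i) := fun i =>
      DFunLike.congr_fun (congrArg Subtype.val h) i
    refine Subtype.ext (Finsupp.ext fun o => ?_)
    cases o with
    | some i => exact hs i
    | none =>
      have h1 := hmem n
      have h2 := hmem n'
      simp only [hs] at h1
      omega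
  have hfin : Module.Finite K (restrictTotalDegree ι K k) := inferInstance
  rw [restrictTotalDegree] at hfin ⊢
  have : Finite {n : ι →₀ ℕ | (n.sum fun _ e => e) ≤ k} :=
    Module.Finite.finite_basis (basisRestrictSupport K _)
  rw [Module.finrank_eq_nat_card_basis (basisRestrictSupport K _)]
  have hc := Nat.card_le_card_of_injective e he
  rw [Nat.card_eq_fintype_card, Fintype.card_coe, Finset.card_finsuppAntidiag_nat_eq_choose,
    Finset.card_univ, Fintype.card_option, add_right_comm, Nat.add_sub_cancel, add_comm,
    Nat.choose_symm_add] at hc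
  exact hc

end Dimension

theorem le_factorial_mul_pow_of_choose_mul_le {N s d e : ℕ}
    (h : ∀ k, N * (k + s).choose s ≤ (d * k + e + 1) ^ s) : N ≤ s.factorial * d ^ s := by
  have hle : ∀ k : ℕ, (N : ℝ) ≤ s.factorial * (d + (e + 1) * (1 / ((k : ℝ) + 1))) ^ s := by
    intro k
    have hk : (0 : ℝ) < k + 1 := by positivity
    have h1 : ((k : ℝ) + 1) ^ s / s.factorial ≤ (k + s).choose s := by
      have := Nat.pow_le_choose (α := ℝ) s (k + s)
      rwa [show k + s + 1 - s = k + 1 by omega, Nat.cast_add_one] at this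
    have h2 : (N : ℝ) * (k + s).choose s ≤ (d * k + e + 1) ^ s := mod_cast h k
    have h3 : (N : ℝ) * ((k + 1) ^ s / s.factorial) ≤ (d * (k + 1) + (e + 1)) ^ s :=
      (mul_le_mul_of_nonneg_left h1 (by positivity)).trans (h2.trans (by gcongr ?_ ^ s; nlinarith))
    have h4 : (d : ℝ) + (e + 1) * (1 / (k + 1)) = (d * (k + 1) + (e + 1)) / (k + 1) := by
      field_simp
    rw [h4, div_pow, ← mul_div_assoc, le_div_iff₀ (by positivity)]
    rw [← mul_div_assoc, div_le_iff₀ (by positivity)] at h3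
    linarith
  have hlim : Filter.Tendsto
      (fun k : ℕ => (s.factorial : ℝ) * (d + (e + 1) * (1 / ((k : ℝ) + 1))) ^ s)
      Filter.atTop (nhds (s.factorial * (d + (e + 1) * 0) ^ s)) :=
    (((tendsto_one_div_add_atTop_nhds_zero_nat.const_mul _).const_add _).pow s).const_mul _
  have := ge_of_tendsto' hlim hle
  rw [mul_zero, add_zero] at this
  exact_mod_cast this

/-- A square system of polynomials of degree at most `d` in each of its `s` variables has at most
`s! d ^ s` non-degenerate zeros. -/
theorem card_nondegenerate_zeros_le {K ι : Type*} [Field K] [Infinite K] [Fintype ι]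
    [DecidableEq ι] {d : ℕ} (f : ι → MvPolynomial ι K) (hd : ∀ j i, (f j).degreeOf i ≤ d)
    (T : Finset (ι → K)) (hf : ∀ ξ ∈ T, ∀ j, eval ξ (f j) = 0)
    (hJ : ∀ ξ ∈ T, (Matrix.of fun j l => eval ξ (pderiv l (f j))).det ≠ 0) :
    T.card ≤ (Fintype.card ι).factorial * d ^ Fintype.card ι := by
  obtain ⟨a, ha, ha'⟩ := exists_separating T
  set e : ℕ := Finset.univ.sup fun i : T => (a i).totalDegree
  refine le_factorial_mul_pow_of_choose_mul_le (e := e) fun k => ?_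
  let Φ : (T → restrictTotalDegree ι K k) →ₗ[K] MvPolynomial ι K :=
    ∑ i, LinearMap.mulLeft K (a i) ∘ₗ (aeval f).toLinearMap ∘ₗ
      (restrictTotalDegree ι K k).subtype ∘ₗ LinearMap.proj i
  have hΦ : ∀ g, Φ g = ∑ i, a i * aeval f (g i : MvPolynomial ι K) := fun g => by
    simp [Φ, LinearMap.sum_apply]
  have hmem : ∀ g, Φ g ∈ restrictDegree ι K (d * k + e) := by
    intro g
    rw [hΦ]
    refine Submodule.sum_mem _ fun i _ => (mem_restrictDegree _ _ _).mpr fun s hs l => ?_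
    refine degreeOf_le_iff.mp ((degreeOf_mul_le l _ _).trans ?_) s hs
    rw [add_comm]
    refine add_le_add (degreeOf_aeval_le fun m hm => ?_) ((degreeOf_le_totalDegree _ _).trans
      (Finset.le_sup (f := fun i : T => (a i).totalDegree) (Finset.mem_univ i)))
    have hk : (m.sum fun _ e => e) ≤ k :=
      (le_totalDegree hm).trans ((mem_restrictTotalDegree _ _ _).mp (g i).2)
    calc (m.sum fun j e => e * (f j).degreeOf l) ≤ m.sum fun _ e => e * d :=
          Finset.sum_le_sum fun j _ => Nat.mul_le_mul_left _ (hd j l)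
      _ = d * m.sum fun _ e => e := by rw [Finsupp.sum, ← Finset.sum_mul, mul_comm]; rfl
      _ ≤ d * k := Nat.mul_le_mul_left _ hk
  have hinj : Function.Injective (Φ.codRestrict _ hmem) := by
    rw [LinearMap.injective_codRestrict_iff, injective_iff_map_eq_zero]
    intro g hg
    rw [hΦ] at hg
    exact funext fun i => Subtype.ext <| eq_zero_of_sum_mul_aeval_eq_zero f T hf hJ a ha ha'
      (fun i => (g i : MvPolynomial ι K)) hg i
  have hrank := LinearMap.finrank_le_finrank_of_injective hinj
  rw [Module.finrank_pi_fintype, Finset.sum_const, Finset.card_univ, Fintype.card_coe,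
    smul_eq_mul] at hrank
  exact (Nat.mul_le_mul_left _ (choose_le_finrank_restrictTotalDegree K ι k)).trans
    (hrank.trans (finrank_restrictDegree_le K ι _))

section Plane

variable {n : ℕ} (S : Finset (Fin n)) (c : Fin n → ℝ)

/-- Restriction of a polynomial to the plane `{x : x_j = c_j for j ∉ S}`. -/
noncomputable def restrictPlane : MvPolynomial (Fin n) ℝ →ₐ[ℝ] MvPolynomial {j // j ∈ S} ℝ :=
  aeval fun j => if h : j ∈ S then X ⟨j, h⟩ else C (c j)

theorem eval_restrictPlane (y : {j // j ∈ S} → ℝ) (q : MvPolynomial (Fin n) ℝ) :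
    eval y (restrictPlane S c q) = eval (planePt S c y) q := by
  induction q using MvPolynomial.induction_on with
  | C a => simp [restrictPlane]
  | add p q hp hq => simp [hp, hq]
  | mul_X p j hp =>
    rw [map_mul, map_mul, map_mul, hp, eval_X, restrictPlane, aeval_X, planePt]
    split_ifs <;> simp

theorem pderiv_restrictPlane (l : {j // j ∈ S}) (q : MvPolynomial (Fin n) ℝ) :
    pderiv l (restrictPlane S c q) = restrictPlane S c (pderiv (l : Fin n) q) := by
  induction q using MvPolynomial.induction_on with
  | C a => simp [restrictPlane]
  | add p q hp hq => simp [hp, hq]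
  | mul_X p j hp =>
    have hX : pderiv l (restrictPlane S c (X j)) =
        restrictPlane S c (pderiv (l : Fin n) (X j)) := by
      by_cases h : j ∈ S
      · by_cases hj : j = l
        · subst hj; simp [restrictPlane]
        · have : (⟨j, h⟩ : {j // j ∈ S}) ≠ l := fun h' => hj (congrArg Subtype.val h')
          simp [restrictPlane, h, pderiv_X_of_ne this, pderiv_X_of_ne hj]
      · have : j ≠ l := fun h' => h (h' ▸ l.2)
        simp [restrictPlane, h, pderiv_X_of_ne this]
    simp only [map_mul, Derivation.leibniz, hp, hX, smul_eq_mul, map_add]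

theorem degreeOf_restrictPlane_le (i : {j // j ∈ S}) (q : MvPolynomial (Fin n) ℝ) :
    (restrictPlane S c q).degreeOf i ≤ q.degreeOf (i : Fin n) := by
  refine degreeOf_aeval_le fun m hm => ?_
  rw [Finsupp.sum_fintype _ _ fun _ => zero_mul _,
    Finset.sum_eq_single (i : Fin n) (fun j _ hj => ?_) fun h => (h (Finset.mem_univ _)).elim]
  · simpa using degreeOf_le_iff.mp le_rfl m hm
  · by_cases h : j ∈ S
    · have : i ≠ ⟨j, h⟩ := fun h' => hj (congrArg Subtype.val h').symm
      simp [h, degreeOf_X_of_ne this]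
    · simp [h]

end Plane

/-- For a real polynomial `p` of multi-degree `d` (every variable appears with degree
at most `d`), the number of non-degenerate real solutions with all coordinates nonzero
of the system `∂p/∂x_j = 0`, `j ∈ S`, restricted to the plane `{x : x_j = c_j, j ∉ S}`
(for nonzero values `c_j`), is at most `s! · d^s` where `s = |S|`. -/
theorem stmt8 {n d : ℕ} (p : MvPolynomial (Fin n) ℝ) (hd : ∀ i, p.degreeOf i ≤ d)
    (S : Finset (Fin n)) (c : Fin n → ℝ) (hc : ∀ j ∉ S, c j ≠ 0) :
    {y : {j // j ∈ S} → ℝ | (∀ j, y j ≠ 0) ∧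
        (∀ j : {j // j ∈ S}, eval (planePt S c y) (pderiv (j : Fin n) p) = 0) ∧
        Matrix.det (Matrix.of fun j l : {j // j ∈ S} =>
          eval (planePt S c y) (pderiv (l : Fin n) (pderiv (j : Fin n) p))) ≠ 0}.Finite ∧
      {y : {j // j ∈ S} → ℝ | (∀ j, y j ≠ 0) ∧
        (∀ j : {j // j ∈ S}, eval (planePt S c y) (pderiv (j : Fin n) p) = 0) ∧
        Matrix.det (Matrix.of fun j l : {j // j ∈ S} =>
          eval (planePt S c y) (pderiv (l : Fin n) (pderiv (j : Fin n) p))) ≠ 0}.ncard ≤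
        S.card.factorial * d ^ S.card := by
  set A := {y : {j // j ∈ S} → ℝ | (∀ j, y j ≠ 0) ∧
        (∀ j : {j // j ∈ S}, eval (planePt S c y) (pderiv (j : Fin n) p) = 0) ∧
        Matrix.det (Matrix.of fun j l : {j // j ∈ S} =>
          eval (planePt S c y) (pderiv (l : Fin n) (pderiv (j : Fin n) p))) ≠ 0}
  have key : ∀ T : Finset ({j // j ∈ S} → ℝ), (T : Set ({j // j ∈ S} → ℝ)) ⊆ A →
      T.card ≤ S.card.factorial * d ^ S.card := by
    intro T hT
    have := card_nondegenerate_zeros_le (d := d)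
      (fun j : {j // j ∈ S} => restrictPlane S c (pderiv (j : Fin n) p))
      (fun j i => (degreeOf_restrictPlane_le S c i _).trans
        ((degreeOf_pderiv_le _ _ _).trans (hd i))) T
      (fun ξ hξ j => by rw [eval_restrictPlane]; exact (hT hξ).2.1 j)
      (fun ξ hξ => by
        simp only [pderiv_restrictPlane, eval_restrictPlane]
        exact (hT hξ).2.2)
    rwa [Fintype.card_coe] at this
  have hfin : A.Finite := by
    by_contra hinf
    obtain ⟨T, hTA, hT⟩ :=
      Set.Infinite.exists_subset_card_eq hinf (S.card.factorial * d ^ S.card + 1)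
    have := key T hTA
    omega
  refine ⟨hfin, ?_⟩
  rw [Set.ncard_eq_toFinset_card A hfin]
  exact key _ (by simp)
end

section
/- Let A ⊆ ℝ^n be a semialgebraic set represented as A = ⋃_{i=1}^k A_i with A_i = ⋂_{j=1}^{j_i} A_{ij}, where each A_{ij} is either {x ∈ ℝ^n : p_{ij}(x) > 0} or {x ∈ ℝ^n : p_{ij}(x) ≥ 0} for a real polynomial p_{ij} of degree d_{ij}, and set d_i = Σ_{j=1}^{j_i} d_{ij}. Then for every ℓ ≥ 1 and every ℓ-dimensional affine subspace P of ℝ^n, the number of connected components of A ∩ P is at most (1/2)·Σ_{i=1}^k (d_i + 2)(d_i + 1)^{ℓ−1}. -/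
open MvPolynomial

/-- The basic set `{x : p(x) > 0}` or `{x : p(x) ≥ 0}` according to the flag `strict`. -/
def basicSet {n : ℕ} (p : MvPolynomial (Fin n) ℝ) (strict : Bool) : Set (Fin n → ℝ) :=
  if strict then {x | 0 < eval x p} else {x | 0 ≤ eval x p}

/-- The set of connected components of a set `S` (as subsets of the ambient space). -/
def compsIn {X : Type*} [TopologicalSpace X] (S : Set X) : Set (Set X) :=
  {T | ∃ x ∈ S, T = connectedComponentIn S x}

/-- No preconnected subset of `B` contains both `x` and `y`. -/
def Disconnected {X : Type*} [TopologicalSpace X] (B : Set X) (x y : X) : Prop :=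
  ∀ T ⊆ B, IsPreconnected T → x ∈ T → y ∉ T

lemma Disconnected.mono {X : Type*} [TopologicalSpace X] {B B' : Set X} {x y : X}
    (h : Disconnected B x y) (hB : B' ⊆ B) : Disconnected B' x y :=
  fun T hT => h T (hT.trans hB)

lemma exists_isClopen_of_disconnected {X : Type*} [TopologicalSpace X] [T2Space X] {K : Set X}
    (hK : IsCompact K) {x y : X} (hx : x ∈ K) (hy : y ∈ K) (h : Disconnected K x y) :
    ∃ Z : Set K, IsClopen Z ∧ (⟨x, hx⟩ : K) ∈ Z ∧ (⟨y, hy⟩ : K) ∉ Z := by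
  have := isCompact_iff_compactSpace.1 hK
  by_contra! hcon
  refine h (Subtype.val '' connectedComponent (⟨x, hx⟩ : K)) (by simp)
    (isPreconnected_connectedComponent.image _ continuous_subtype_val.continuousOn)
    ⟨_, mem_connectedComponent, rfl⟩ ⟨⟨y, hy⟩, ?_, rfl⟩
  rw [connectedComponent_eq_iInter_isClopen, Set.mem_iInter]
  exact fun Z => hcon Z Z.2.1 Z.2.2

lemma exists_isOpen_separation {X : Type*} [TopologicalSpace X] [T2Space X] {K : Set X}
    (hK : IsCompact K) (S : Finset X) (hSK : ∀ x ∈ S, x ∈ K)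
    (hS : ∀ x ∈ S, ∀ y ∈ S, x ≠ y → Disconnected K x y) :
    ∃ U V : X → Set X, ∀ x ∈ S, IsOpen (U x) ∧ IsOpen (V x) ∧ x ∈ U x ∧ Disjoint (U x) (V x) ∧
      K ⊆ U x ∪ V x ∧ ∀ y ∈ S, x ≠ y → Disjoint (U x) (U y) := by
  classical
  have hcs := isCompact_iff_compactSpace.1 hK
  have hZ : ∀ x y : X, ∃ Z : Set K, IsClopen Z ∧ (x ∈ S → y ∈ S → x ≠ y →
      (∀ hx : x ∈ K, (⟨x, hx⟩ : K) ∈ Z) ∧ (∀ hy : y ∈ K, (⟨y, hy⟩ : K) ∉ Z)) := by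
    intro x y
    by_cases h : x ∈ S ∧ y ∈ S ∧ x ≠ y
    · obtain ⟨hx, hy, hxy⟩ := h
      obtain ⟨Z, h1, h2, h3⟩ :=
        exists_isClopen_of_disconnected hK (hSK x hx) (hSK y hy) (hS x hx y hy hxy)
      exact ⟨Z, h1, fun _ _ _ => ⟨fun _ => h2, fun _ => h3⟩⟩
    · exact ⟨∅, isClopen_empty, fun hx hy hxy => absurd ⟨hx, hy, hxy⟩ h⟩
  choose Z hZ hZm using hZ
  let C : X → Set K := fun x => ⋂ y ∈ S.erase x, Z x y \ Z y x
  have hC : ∀ x, IsClopen (C x) := fun x =>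
    Set.Finite.isClopen_biInter (S.erase x).finite_toSet fun y _ => (hZ x y).diff (hZ y x)
  have hCx : ∀ x ∈ S, ∀ hx : x ∈ K, (⟨x, hx⟩ : K) ∈ C x := by
    intro x hxS hx
    refine Set.mem_iInter₂.2 fun y hy => ?_
    obtain ⟨hyx, hyS⟩ := Finset.mem_erase.1 hy
    exact ⟨(hZm x y hxS hyS hyx.symm).1 hx, (hZm y x hyS hxS hyx).2 hx⟩
  have hCd : ∀ x ∈ S, ∀ y ∈ S, x ≠ y → C x ⊆ (C y)ᶜ := by
    intro x hx y hy hxy z hz hz'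
    have h1 := Set.mem_iInter₂.1 hz y (Finset.mem_erase.2 ⟨hxy.symm, hy⟩)
    have h2 := Set.mem_iInter₂.1 hz' x (Finset.mem_erase.2 ⟨hxy, hx⟩)
    exact h1.2 h2.1
  have hsep : ∀ x, SeparatedNhds (Subtype.val '' C x) (Subtype.val '' (C x)ᶜ) := fun x =>
    SeparatedNhds.of_isCompact_isCompact
      ((hC x).isClosed.isCompact.image continuous_subtype_val)
      ((hC x).compl.isClosed.isCompact.image continuous_subtype_val)
      (by
        rw [Set.disjoint_image_iff Subtype.val_injective]
        exact disjoint_compl_right)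
  choose U V hU hV hCU hCV hUV using hsep
  refine ⟨fun x => U x ∩ ⋂ y ∈ S.erase x, V y, V, fun x hx =>
    ⟨?_, hV x, ?_, (hUV x).mono_left Set.inter_subset_left, ?_, ?_⟩⟩
  · exact (hU x).inter (isOpen_biInter_finset fun y _ => hV y)
  · have h1 := hCx x hx (hSK x hx)
    refine ⟨hCU x ⟨_, h1, rfl⟩, Set.mem_iInter₂.2 fun y hy => ?_⟩
    obtain ⟨hyx, hyS⟩ := Finset.mem_erase.1 hy
    exact hCV y ⟨_, hCd x hx y hyS hyx.symm h1, rfl⟩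
  · intro z hz
    by_cases h : (⟨z, hz⟩ : K) ∈ C x
    · refine Or.inl ⟨hCU x ⟨_, h, rfl⟩, Set.mem_iInter₂.2 fun y hy => ?_⟩
      obtain ⟨hyx, hyS⟩ := Finset.mem_erase.1 hy
      exact hCV y ⟨_, hCd x hx y hyS hyx.symm h, rfl⟩
    · exact Or.inr (hCV x ⟨_, h, rfl⟩)
  · intro y hy hxy
    refine Set.disjoint_left.2 fun z hz hz' => ?_
    exact Set.disjoint_left.1 (hUV y) hz'.1
      (Set.mem_iInter₂.1 hz.2 y (Finset.mem_erase.2 ⟨hxy.symm, hy⟩))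

lemma exists_pos_relaxation_subset {X ι : Type*} [TopologicalSpace X] [Fintype ι] {K O : Set X}
    (hK : IsCompact K) (hO : IsOpen O) (q : ι → X → ℝ) (hq : ∀ j, Continuous (q j))
    (h : ∀ x ∈ K, (∀ j, 0 ≤ q j x) → x ∈ O) :
    ∃ δ > 0, ∀ x ∈ K, (∀ j, -δ ≤ q j x) → x ∈ O := by
  let g : X → ℝ := fun x => ∑ j, max 0 (-q j x)
  have hg : Continuous g := by fun_prop
  rcases (K \ O).eq_empty_or_nonempty with he | hne
  · exact ⟨1, one_pos, fun x hx _ => by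
      by_contra hxO
      exact Set.eq_empty_iff_forall_notMem.1 he x ⟨hx, hxO⟩⟩
  obtain ⟨x₀, hx₀, hmin⟩ := (hK.diff hO).exists_isMinOn hne hg.continuousOn
  have hpos : 0 < g x₀ := by
    by_contra! hle
    refine hx₀.2 (h x₀ hx₀.1 fun j => ?_)
    have := (Finset.single_le_sum (f := fun j => max 0 (-q j x₀))
      (fun i _ => le_max_left _ _) (Finset.mem_univ j)).trans hle
    have h2 := (le_max_right 0 (-q j x₀)).trans this
    linarith
  refine ⟨g x₀ / (Fintype.card ι + 1), by positivity, fun x hx hqx => ?_⟩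
  by_contra hxO
  have h1 : g x₀ ≤ g x := hmin ⟨hx, hxO⟩
  have h2 : g x ≤ ∑ _j : ι, g x₀ / (Fintype.card ι + 1) :=
    Finset.sum_le_sum fun j _ => max_le (by positivity) (by linarith [hqx j])
  rw [Finset.sum_const, Finset.card_univ, nsmul_eq_mul, mul_div_assoc', le_div_iff₀ (by positivity)]
    at h2
  nlinarith

lemma hasDerivAt_eval_add_smul {σ : Type*} [Fintype σ] (p : MvPolynomial σ ℝ) (q v : σ → ℝ) :
    HasDerivAt (fun s : ℝ => eval (q + s • v) p) (∑ i, v i * eval q (pderiv i p)) 0 := by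
  classical
  induction p using MvPolynomial.induction_on with
  | C a => simpa using hasDerivAt_const (0 : ℝ) a
  | add p r hp hr =>
    simp only [map_add, mul_add, Finset.sum_add_distrib]
    exact hp.add hr
  | mul_X p j hp =>
    have h1 : HasDerivAt (fun s : ℝ => (q + s • v) j) (v j) 0 := by
      simpa using ((hasDerivAt_id (0 : ℝ)).mul_const (v j)).const_add (q j)
    have h2 := hp.mul h1
    simp only [map_mul, eval_X]
    refine h2.congr_deriv ?_
    simp only [zero_smul, add_zero, pderiv_mul, pderiv_X, map_add, map_mul, eval_X, mul_add,
      Finset.sum_add_distrib, Finset.sum_mul]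
    congr 1
    · exact Finset.sum_congr rfl fun i _ => by ring
    · rw [Finset.sum_eq_single j]
      · simp; ring
      · intro i _ hij
        simp [hij.symm]
      · simp

/-- At a local maximum of `c * x i₀` on `{F ≥ 0}`, both `F` and its partial derivatives in the
other directions vanish. -/
lemma eval_eq_zero_of_local_extremum {σ : Type*} [Fintype σ] (F : MvPolynomial σ ℝ) (i₀ : σ)
    {c : ℝ} (hc : c ≠ 0) {q : σ → ℝ} {O : Set (σ → ℝ)} (hO : IsOpen O) (hqO : q ∈ O)
    (hq : 0 ≤ eval q F) (hmax : ∀ y ∈ O, 0 ≤ eval y F → c * y i₀ ≤ c * q i₀) :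
    eval q F = 0 ∧ ∀ i ≠ i₀, eval q (pderiv i F) = 0 := by
  classical
  have key : ∀ v : σ → ℝ, 0 < c * v i₀ →
      ¬ ∀ᶠ s : ℝ in nhdsWithin 0 (Set.Ioi 0), 0 ≤ eval (q + s • v) F := by
    intro v hv hev
    have hcont : Continuous fun s : ℝ => q + s • v := by fun_prop
    have h1 : ∀ᶠ s : ℝ in nhds 0, q + s • v ∈ O :=
      hcont.continuousAt.eventually_mem (hO.mem_nhds (by simpa using hqO))
    obtain ⟨s, ⟨hs0, hs1⟩, hs2⟩ := ((hev.and (h1.filter_mono nhdsWithin_le_nhds)).and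
      self_mem_nhdsWithin).exists
    have := hmax _ hs1 hs0
    simp only [Pi.add_apply, Pi.smul_apply, smul_eq_mul] at this
    have hspos : 0 < s := hs2
    nlinarith [mul_pos hspos hv]
  have h0 : eval q F = 0 := by
    by_contra hne
    have hpos : 0 < eval q F := lt_of_le_of_ne hq (Ne.symm hne)
    refine key (Pi.single i₀ c) (by simpa using mul_self_pos.2 hc) ?_
    have hcont : Continuous fun s : ℝ => eval (q + s • (Pi.single i₀ c : σ → ℝ)) F :=
      (continuous_eval F).comp (by fun_prop)
    have := (hcont.tendsto' 0 (eval q F) (by simp)).eventually (eventually_gt_nhds hpos)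
    exact (this.filter_mono nhdsWithin_le_nhds).mono fun s hs => le_of_lt hs
  refine ⟨h0, fun i hi => ?_⟩
  by_contra hne
  refine key (Pi.single i₀ c + Pi.single i
    ((1 - c * eval q (pderiv i₀ F)) / eval q (pderiv i F))) ?_ ?_
  · simpa [Pi.single_apply, hi.symm] using mul_self_pos.2 hc
  · have hd := hasDerivAt_eval_add_smul F q (Pi.single i₀ c + Pi.single i
      ((1 - c * eval q (pderiv i₀ F)) / eval q (pderiv i F)))
    have hsum : ∑ j, (Pi.single i₀ c + Pi.single i
        ((1 - c * eval q (pderiv i₀ F)) / eval q (pderiv i F)) : σ → ℝ) j *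
          eval q (pderiv j F) = 1 := by
      simp [add_mul, Finset.sum_add_distrib, Pi.single_apply, div_mul_cancel₀ _ hne]
    rw [hsum] at hd
    have hs := hd.tendsto_slope_zero_right.eventually (eventually_gt_nhds (zero_lt_one' ℝ))
    filter_upwards [hs, self_mem_nhdsWithin] with s hs1 hs2
    simp only [zero_add, zero_smul, add_zero, h0, sub_zero, smul_eq_mul] at hs1
    have hspos : 0 < s := hs2
    exact (pos_of_mul_pos_right hs1 (inv_nonneg.2 hspos.le)).le

/-- Polynomials of degree less than the number of points separate a finite set of points. -/
lemma exists_eval_eq_one_and_eval_eq_zero {σ : Type*} (Z : Finset (σ → ℝ)) {y : σ → ℝ}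
    (hy : y ∈ Z) : ∃ p : MvPolynomial σ ℝ, p.totalDegree ≤ Z.card - 1 ∧ eval y p = 1 ∧
      ∀ z ∈ Z, z ≠ y → eval z p = 0 := by
  classical
  have hne : ∀ z : σ → ℝ, ∃ q : MvPolynomial σ ℝ, q.totalDegree ≤ 1 ∧ eval y q = 1 ∧
      (z ≠ y → eval z q = 0) := by
    intro z
    by_cases h : z = y
    · exact ⟨1, by simp, by simp, fun h' => absurd h h'⟩
    · obtain ⟨i, hi⟩ := Function.ne_iff.1 h
      refine ⟨C (y i - z i)⁻¹ * (X i - C (z i)), ?_, ?_, fun _ => by simp⟩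
      · refine (totalDegree_mul _ _).trans ?_
        rw [totalDegree_C, zero_add]
        exact (totalDegree_sub_C_le _ _).trans (totalDegree_X _).le
      · have := sub_ne_zero.2 (Ne.symm hi)
        simp [this]
  choose q hq hq1 hq0 using hne
  refine ⟨∏ z ∈ Z.erase y, q z, ?_, ?_, ?_⟩
  · refine (totalDegree_finsetProd _ _).trans ?_
    rw [← Finset.card_erase_of_mem hy, Finset.card_eq_sum_ones]
    exact Finset.sum_le_sum fun z _ => hq z
  · rw [map_prod]
    exact Finset.prod_eq_one fun z _ => hq1 z
  · intro z hz hzy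
    rw [map_prod]
    exact Finset.prod_eq_zero (Finset.mem_erase.2 ⟨hzy, hz⟩) (hq0 z hzy)

/-- A Bézout-type bound: for polynomials `a i` of degree at most `e i`, the system
`a i = t * x i ^ e i` has at most `∏ i, e i` real solutions, for all but finitely many `t`. -/
theorem finite_setOf_many_zeros {σ : Type*} [Fintype σ] (a : σ → MvPolynomial σ ℝ) (e : σ → ℕ)
    (ha : ∀ i, (a i).totalDegree ≤ e i) :
    {t : ℝ | ∃ Z : Finset (σ → ℝ), ∏ i, e i < Z.card ∧
      ∀ z ∈ Z, ∀ i, eval z (a i) = t * z i ^ e i}.Finite := by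
  classical
  obtain ⟨N, hN⟩ : ∃ N, N = ∏ i, e i := ⟨_, rfl⟩
  rw [← hN]
  have hm : ∀ α : σ →₀ ℕ, ∃ m : MvPolynomial σ ℝ, ((∀ i, α i < e i) ∧ m = 0) ∨
      ∃ i β, α = β + Finsupp.single i (e i) ∧ m = monomial β 1 * a i := by
    intro α
    by_cases h : ∃ i, e i ≤ α i
    · obtain ⟨i, hi⟩ := h
      have hle : Finsupp.single i (e i) ≤ α := by simpa using hi
      exact ⟨_, Or.inr ⟨i, _, (tsub_add_cancel_of_le hle).symm, rfl⟩⟩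
    · push Not at h
      exact ⟨0, Or.inl ⟨h, rfl⟩⟩
  choose m hm using hm
  obtain ⟨M, hM⟩ : ∃ M : MvPolynomial σ ℝ →ₗ[ℝ] MvPolynomial σ ℝ,
      ∀ α c, M (monomial α c) = c • m α := by
    refine ⟨(basisMonomials σ ℝ).constr ℝ m, fun α c => ?_⟩
    have h1 : monomial α c = c • (basisMonomials σ ℝ α) := by simp [smul_monomial]
    rw [h1, map_smul, Module.Basis.constr_basis]
  have hMV : ∀ p ∈ restrictTotalDegree σ ℝ N, M p ∈ restrictTotalDegree σ ℝ N := by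
    intro p hp
    rw [mem_restrictTotalDegree] at hp
    rw [p.as_sum, map_sum]
    refine Submodule.sum_mem _ fun α hα => ?_
    rw [hM]
    refine Submodule.smul_mem _ _ ?_
    rw [mem_restrictTotalDegree]
    have hα' : α.degree ≤ N := (le_totalDegree hα).trans hp
    rcases hm α with ⟨-, h⟩ | ⟨i, β, rfl, h⟩
    · simp [h]
    · rw [h]
      refine (totalDegree_mul _ _).trans ?_
      have h1 : (monomial β (1 : ℝ)).totalDegree ≤ β.degree := totalDegree_monomial_le _ _
      have h2 := ha i
      rw [map_add, Finsupp.degree_single] at hα'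
      omega
  obtain ⟨Mk, hMk⟩ : ∃ Mk : Module.End ℝ (restrictTotalDegree σ ℝ N),
      ∀ p, (Mk p : MvPolynomial σ ℝ) = M p := ⟨M.restrict hMV, fun p => rfl⟩
  refine Mk.finite_hasEigenvalue.subset ?_
  rintro t ⟨Z', hZ', hz'⟩
  obtain ⟨Z, hZZ, hZ⟩ := Finset.exists_subset_card_eq (Nat.succ_le_of_lt hZ')
  have hz : ∀ z ∈ Z, ∀ i, eval z (a i) = t * z i ^ e i := fun z h => hz' z (hZZ h)
  by_contra hev
  have hunit : IsUnit (algebraMap ℝ (Module.End ℝ (restrictTotalDegree σ ℝ N)) t - Mk) := by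
    by_contra h
    exact hev (Module.End.hasEigenvalue_iff_mem_spectrum.2 h)
  have hsurj := ((Module.End.isUnit_iff _).1 hunit).2
  obtain ⟨ev, hev'⟩ : ∃ ev : MvPolynomial σ ℝ →ₗ[ℝ] (Z → ℝ),
      ∀ p (z : Z), ev p z = eval (z : σ → ℝ) p :=
    ⟨LinearMap.pi fun z => (aeval (z : σ → ℝ)).toLinearMap, fun p z => by
      simp [aeval_eq_eval]⟩
  let b : ((i : σ) → Fin (e i)) → (Z → ℝ) := fun β =>
    ev (monomial (Finsupp.equivFunOnFinite.symm fun i => (β i : ℕ)) 1)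
  have hS : ∀ p, ev (t • p - M p) ∈ Submodule.span ℝ (Set.range b) := by
    intro p
    induction p using MvPolynomial.induction_on' with
    | monomial α c =>
      rw [hM, show monomial α c = c • monomial α (1 : ℝ) by simp [smul_monomial],
        smul_comm, ← smul_sub, map_smul]
      refine Submodule.smul_mem _ _ ?_
      rcases hm α with ⟨h, h0⟩ | ⟨i, β, rfl, h⟩
      · rw [h0, sub_zero, map_smul]
        refine Submodule.smul_mem _ _ (Submodule.subset_span ⟨fun i => ⟨α i, h i⟩, ?_⟩)
        refine congrArg ev (congrArg (fun γ => monomial γ (1 : ℝ)) ?_)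
        ext i
        simp
      · have : ev (t • monomial (β + Finsupp.single i (e i)) 1 -
            m (β + Finsupp.single i (e i))) = 0 := by
          ext z
          rw [hev', h, ← one_mul (1 : ℝ), ← monomial_mul, ← X_pow_eq_monomial]
          simp only [map_sub, smul_eval, map_mul, map_pow, eval_X, Pi.zero_apply, one_mul,
            hz _ z.2]
          ring
        rw [this]
        exact Submodule.zero_mem _
    | add p q hp hq =>
      have : t • (p + q) - M (p + q) = (t • p - M p) + (t • q - M q) := by
        rw [map_add, smul_add]; abel
      rw [this, map_add]
      exact Submodule.add_mem _ hp hq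
  have hpt : ∀ y : Z, (Pi.single y 1 : Z → ℝ) ∈ Submodule.span ℝ (Set.range b) := by
    intro y
    obtain ⟨p, hp, hp1, hp0⟩ := exists_eval_eq_one_and_eval_eq_zero Z y.2
    obtain ⟨q, hq⟩ := hsurj ⟨p, (mem_restrictTotalDegree _ _ _).2 (hp.trans (by omega))⟩
    have hq' : t • (q : MvPolynomial σ ℝ) - M q = p := by
      have := congrArg Subtype.val hq
      rw [LinearMap.sub_apply, Module.algebraMap_end_apply] at this
      rw [← hMk]
      exact this
    have : (Pi.single y 1 : Z → ℝ) = ev p := by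
      ext z
      rw [hev']
      by_cases hzy : z = y
      · subst hzy; simp [hp1]
      · rw [Pi.single_eq_of_ne hzy, hp0 z z.2 (fun h => hzy (Subtype.ext h))]
    rw [this, ← hq']
    exact hS _
  have htop : Submodule.span ℝ (Set.range b) = ⊤ := by
    rw [eq_top_iff, ← (Pi.basisFun ℝ Z).span_eq, Submodule.span_le]
    rintro _ ⟨y, rfl⟩
    rw [Pi.basisFun_apply]
    exact hpt y
  have h1 := finrank_range_le_card (R := ℝ) b
  rw [Set.finrank, htop, finrank_top, Module.finrank_fintype_fun_eq_card, Fintype.card_coe,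
    Fintype.card_pi] at h1
  simp only [Fintype.card_fin] at h1
  omega

lemma totalDegree_pderiv_le {σ : Type*} (i : σ) (p : MvPolynomial σ ℝ) :
    (pderiv i p).totalDegree ≤ p.totalDegree - 1 := by
  classical
  conv_lhs => rw [p.as_sum]
  rw [map_sum]
  refine totalDegree_finsetSum_le fun α hα => ?_
  rw [pderiv_monomial]
  by_cases h : α i = 0
  · simp [h]
  · have hle : Finsupp.single i 1 ≤ α := by simpa using Nat.one_le_iff_ne_zero.2 h
    have h1 : (monomial (α - Finsupp.single i 1) (coeff α p * α i)).totalDegree ≤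
        (α - Finsupp.single i 1).degree := totalDegree_monomial_le _ _
    have h2 : α.degree ≤ p.totalDegree := le_totalDegree hα
    rw [← tsub_add_cancel_of_le hle, map_add, Finsupp.degree_single] at h2
    omega

/-- For all but finitely many `t`, the perturbation `f - t * ∑ x i ^ (d + 2)` has at most
`(d + 2) * (d + 1) ^ m` zeros that are critical in all directions but the first. -/
lemma finite_setOf_many_critical_zeros {m d : ℕ} (f : MvPolynomial (Fin (m + 1)) ℝ)
    (hf : f.totalDegree ≤ d + 2) :
    {t : ℝ | ∃ Z : Finset (Fin (m + 1) → ℝ), (d + 2) * (d + 1) ^ m < Z.card ∧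
      ∀ z ∈ Z, eval z (f - C t * ∑ i, X i ^ (d + 2)) = 0 ∧
        ∀ i ≠ 0, eval z (pderiv i (f - C t * ∑ i, X i ^ (d + 2))) = 0}.Finite := by
  classical
  let g : Fin (m + 1) → MvPolynomial (Fin (m + 1)) ℝ := fun i =>
    C ((d + 2 : ℝ)⁻¹) * pderiv i f
  have hg : ∀ i, (g i).totalDegree ≤ d + 1 := fun i => by
    refine (totalDegree_mul _ _).trans ?_
    have := totalDegree_pderiv_le i f
    rw [totalDegree_C]
    omega
  let a : Fin (m + 1) → MvPolynomial (Fin (m + 1)) ℝ :=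
    Fin.cons (f - ∑ i : Fin m, X i.succ * g i.succ) fun i => g i.succ
  let e : Fin (m + 1) → ℕ := Fin.cons (d + 2) fun _ => d + 1
  have ha : ∀ i, (a i).totalDegree ≤ e i := by
    intro i
    refine Fin.cases ?_ (fun i => ?_) i
    · simp only [a, e, Fin.cons_zero]
      refine (totalDegree_sub _ _).trans (max_le hf (totalDegree_finsetSum_le fun i _ => ?_))
      refine (totalDegree_mul _ _).trans ?_
      rw [totalDegree_X]
      have := hg i.succ
      omega
    · simpa only [a, e, Fin.cons_succ] using hg i.succ
  refine (finite_setOf_many_zeros a e ha).subset ?_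
  rintro t ⟨Z, hZ, hz⟩
  refine ⟨Z, by simpa [Fin.prod_univ_succ, e] using hZ, fun z hzZ => ?_⟩
  obtain ⟨h0, h1⟩ := hz z hzZ
  have hd : (d + 2 : ℝ) ≠ 0 := by positivity
  have hs : ∀ i : Fin m, eval z (g i.succ) = t * z i.succ ^ (d + 1) := by
    intro i
    have h := h1 i.succ (Fin.succ_ne_zero i)
    have hp : pderiv i.succ (∑ j, X j ^ (d + 2) : MvPolynomial (Fin (m + 1)) ℝ) =
        C (d + 2 : ℝ) * X i.succ ^ (d + 1) := by
      rw [map_sum, Finset.sum_eq_single i.succ]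
      · rw [pderiv_pow, pderiv_X_self, mul_one, ← map_natCast C (d + 2), Nat.cast_add,
          Nat.cast_ofNat]
        rfl
      · intro j _ hj
        rw [pderiv_pow, pderiv_X_of_ne hj, mul_zero]
      · simp
    rw [map_sub, pderiv_C_mul, hp] at h
    simp only [map_sub, map_mul, eval_C, map_pow, eval_X] at h
    simp only [g, map_mul, eval_C]
    field_simp
    linarith
  intro i
  refine Fin.cases ?_ (fun i => ?_) i
  · simp only [a, e, Fin.cons_zero, map_sub, map_sum, map_mul, eval_X, hs]
    simp only [map_sub, map_mul, eval_C, map_sum, map_pow, eval_X] at h0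
    rw [Fin.sum_univ_succ] at h0
    have : ∑ i : Fin m, z i.succ * (t * z i.succ ^ (d + 1)) =
        t * ∑ i : Fin m, z i.succ ^ (d + 2) := by
      rw [Finset.mul_sum]
      exact Finset.sum_congr rfl fun i _ => by ring
    rw [this]
    linarith
  · simpa only [a, e, Fin.cons_succ] using hs i

/-- The bound for closed basic sets. -/
lemma card_le_of_disconnected_closed {m : ℕ} {ι : Type*} [Fintype ι]
    (q : ι → MvPolynomial (Fin (m + 1)) ℝ) {d : ℕ} (hd : ∑ j, (q j).totalDegree ≤ d)
    (S : Finset (Fin (m + 1) → ℝ)) (hSq : ∀ x ∈ S, ∀ j, 0 ≤ eval x (q j))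
    (hS : ∀ x ∈ S, ∀ y ∈ S, x ≠ y → Disconnected {z | ∀ j, 0 ≤ eval z (q j)} x y) :
    2 * S.card ≤ (d + 2) * (d + 1) ^ m := by
  classical
  -- a ball containing `S`
  obtain ⟨ρ, hρ⟩ : ∃ ρ : ℝ, ∀ x ∈ S, ∑ i, x i ^ 2 < ρ := by
    obtain ⟨ρ, hρ⟩ := (S.finite_toSet.image fun x => ∑ i, x i ^ 2).bddAbove
    exact ⟨ρ + 1, fun x hx => lt_of_le_of_lt (hρ ⟨x, hx, rfl⟩) (lt_add_one ρ)⟩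
  let B : Set (Fin (m + 1) → ℝ) := {x | ∑ i, x i ^ 2 ≤ ρ}
  have hB : IsCompact B := by
    refine Metric.isCompact_of_isClosed_isBounded
      (isClosed_le (by fun_prop) continuous_const) ?_
    refine (Metric.isBounded_closedBall (x := 0) (r := ρ + 1)).subset fun x hx => ?_
    have hx' : ∑ i, x i ^ 2 ≤ ρ := hx
    have hρ0 : 0 ≤ ρ := (Finset.sum_nonneg fun i _ => sq_nonneg (x i)).trans hx'
    rw [mem_closedBall_zero_iff, pi_norm_le_iff_of_nonneg (by linarith)]
    intro i
    have h1 : x i ^ 2 ≤ ρ := (Finset.single_le_sum (f := fun i => x i ^ 2)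
      (fun i _ => sq_nonneg (x i)) (Finset.mem_univ i)).trans hx'
    rw [Real.norm_eq_abs]
    exact abs_le_of_sq_le_sq (by nlinarith) (by linarith)
  have hqc : ∀ j, Continuous fun x => eval x (q j) := fun j => continuous_eval (q j)
  have hK : IsCompact (B ∩ {z | ∀ j, 0 ≤ eval z (q j)}) := by
    refine hB.inter_right ?_
    simp only [Set.ofPred_forall]
    exact isClosed_iInter fun j => isClosed_le continuous_const (hqc j)
  obtain ⟨U, V, hUV⟩ := exists_isOpen_separation hK S (fun x hx => ⟨(hρ x hx).le, hSq x hx⟩)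
    fun x hx y hy hxy => (hS x hx y hy hxy).mono Set.inter_subset_right
  obtain ⟨δ, hδ, hδO⟩ := exists_pos_relaxation_subset (O := ⋂ x ∈ S, (U x ∪ V x)) hB
    (isOpen_biInter_finset fun x hx => (hUV x hx).1.union (hUV x hx).2.1)
    (fun j x => eval x (q j)) hqc
    fun z hz hz' => Set.mem_iInter₂.2 fun x hx => (hUV x hx).2.2.2.2.1 ⟨hz, hz'⟩
  let f : MvPolynomial (Fin (m + 1)) ℝ := (∏ j, (q j + C δ)) * (C ρ - ∑ i, X i ^ 2)
  have hfe : ∀ x, eval x f = (∏ j, (eval x (q j) + δ)) * (ρ - ∑ i, x i ^ 2) := fun x => by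
    simp [f, map_prod]
  have hfd : f.totalDegree ≤ d + 2 := by
    refine (totalDegree_mul _ _).trans (add_le_add ?_ ?_)
    · refine (totalDegree_finsetProd _ _).trans ((Finset.sum_le_sum fun j _ => ?_).trans hd)
      refine (totalDegree_add _ _).trans ?_
      simp
    · refine (totalDegree_sub _ _).trans (max_le (by simp) ?_)
      exact totalDegree_finsetSum_le fun i _ => (totalDegree_X_pow _ _).le
  obtain ⟨τ, hτ, hfτ⟩ : ∃ τ > 0, ∀ x ∈ S, 2 * τ < eval x f := by
    have hfpos : ∀ x ∈ S, 0 < eval x f := fun x hx => by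
      rw [hfe]
      exact mul_pos (Finset.prod_pos fun j _ => by linarith [hSq x hx j])
        (sub_pos.2 (hρ x hx))
    rcases S.eq_empty_or_nonempty with rfl | hne
    · exact ⟨1, one_pos, by simp⟩
    · obtain ⟨x₀, hx₀, hmin⟩ := S.exists_min_image (fun x => eval x f) hne
      refine ⟨eval x₀ f / 4, by linarith [hfpos x₀ hx₀], fun x hx => ?_⟩
      have := hmin x hx
      have := hfpos x₀ hx₀
      linarith
  -- the generic perturbation
  let G : (Fin (m + 1) → ℝ) → ℝ := fun x => ∑ i, x i ^ (d + 2)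
  have hG : Continuous G := by fun_prop
  obtain ⟨M, hM⟩ := hB.exists_bound_of_continuousOn hG.continuousOn
  have hbad := finite_setOf_many_critical_zeros (f - C τ) ((totalDegree_sub_C_le f τ).trans hfd)
  obtain ⟨t, ⟨ht0, ht1⟩, htbad⟩ :=
    ((Set.Ioo_infinite (show (0 : ℝ) < τ / (|M| + 1) by positivity)).sdiff hbad).nonempty
  have htG : ∀ x ∈ B, |t * G x| < τ := by
    intro x hx
    have h1 : |G x| ≤ |M| := (hM x hx).trans (le_abs_self M)
    rw [abs_mul, abs_of_pos ht0]
    rw [lt_div_iff₀ (by positivity)] at ht1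
    nlinarith [abs_nonneg (G x)]
  obtain ⟨F, hF⟩ : ∃ F, F = f - C τ - C t * ∑ i, X i ^ (d + 2) := ⟨_, rfl⟩
  have hFe : ∀ x, eval x F = eval x f - τ - t * G x := fun x => by
    simp [hF, G]
  have hFS : ∀ x ∈ S, 0 < eval x F := fun x hx => by
    have h1 := (abs_lt.1 (htG x (hρ x hx).le)).2
    have h2 := hfτ x hx
    rw [hFe]
    linarith
  let W : Set (Fin (m + 1) → ℝ) := B ∩ {z | ∀ j, -δ ≤ eval z (q j)}
  let W' : Set (Fin (m + 1) → ℝ) := {z | ∑ i, z i ^ 2 < ρ} ∩ {z | ∀ j, -δ < eval z (q j)}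
  have hWF : ∀ x ∈ W, 0 ≤ eval x F → x ∈ W' := by
    rintro x ⟨hxB, hxq⟩ hxF
    have h1 := (abs_lt.1 (htG x hxB)).1
    rw [hFe] at hxF
    have h2 : eval x f ≠ 0 := by linarith
    rw [hfe] at h2
    obtain ⟨h3, h4⟩ := mul_ne_zero_iff.1 h2
    refine ⟨lt_of_le_of_ne hxB fun h => h4 (sub_eq_zero.2 h.symm), fun j => ?_⟩
    have h5 := Finset.prod_ne_zero_iff.1 h3 j (Finset.mem_univ j)
    exact lt_of_le_of_ne (hxq j) fun h => h5 (by rw [← h]; ring)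
  have hW'W : W' ⊆ W := fun x hx =>
    ⟨le_of_lt (show ∑ i, x i ^ 2 < ρ from hx.1), fun j => (hx.2 j).le⟩
  have hW'o : IsOpen W' := by
    refine (isOpen_lt (by fun_prop) continuous_const).inter ?_
    simp only [Set.ofPred_forall]
    exact isOpen_iInter_of_finite fun j => isOpen_lt continuous_const (hqc j)
  have hFc : Continuous fun x => eval x F := continuous_eval F
  have hSW' : ∀ x ∈ S, x ∈ W' := fun x hx => ⟨hρ x hx, fun j => by linarith [hSq x hx j]⟩
  -- extremal points on each piece
  have hext : ∀ x ∈ S, ∃ u v : Fin (m + 1) → ℝ, u ∈ U x ∧ v ∈ U x ∧ u ≠ v ∧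
      (eval u F = 0 ∧ ∀ i ≠ 0, eval u (pderiv i F) = 0) ∧
      (eval v F = 0 ∧ ∀ i ≠ 0, eval v (pderiv i F) = 0) := by
    intro x hx
    obtain ⟨hUo, hVo, hxU, hdUV, -, -⟩ := hUV x hx
    let L : Set (Fin (m + 1) → ℝ) := (W ∩ {z | 0 ≤ eval z F}) ∩ (V x)ᶜ
    have hWL : ∀ z ∈ W' ∩ U x, 0 ≤ eval z F → z ∈ L := fun z hz hzF =>
      ⟨⟨hW'W hz.1, hzF⟩, fun h => Set.disjoint_left.1 hdUV hz.2 h⟩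
    have hLW : ∀ z ∈ L, z ∈ W' ∩ U x := by
      rintro z ⟨⟨hzW, hzF⟩, hzV⟩
      refine ⟨hWF z hzW hzF, ?_⟩
      exact (Set.mem_iInter₂.1 (hδO z hzW.1 hzW.2) x hx).resolve_right hzV
    have hLc : IsCompact L := by
      refine ((hB.inter_right ?_).inter_right (isClosed_le continuous_const hFc)).inter_right
        hVo.isClosed_compl
      simp only [Set.ofPred_forall]
      exact isClosed_iInter fun j => isClosed_le continuous_const (hqc j)
    have hxO : x ∈ W' ∩ U x := ⟨hSW' x hx, hxU⟩
    have hxL : x ∈ L := hWL x hxO (hFS x hx).le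
    have hOo : IsOpen (W' ∩ U x) := hW'o.inter hUo
    have hc0 : ContinuousOn (fun z : Fin (m + 1) → ℝ => z 0) L :=
      (continuous_apply 0).continuousOn
    obtain ⟨u, huL, hu⟩ := hLc.exists_isMaxOn ⟨x, hxL⟩ hc0
    obtain ⟨v, hvL, hv⟩ := hLc.exists_isMinOn ⟨x, hxL⟩ hc0
    refine ⟨u, v, (hLW u huL).2, (hLW v hvL).2, ?_, ?_, ?_⟩
    · rintro rfl
      refine (hFS x hx).ne' (eval_eq_zero_of_local_extremum F 0 one_ne_zero hOo hxO
        (hFS x hx).le fun y hy hyF => ?_).1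
      have h1 : y 0 ≤ u 0 := hu (hWL y hy hyF)
      have h2 : u 0 ≤ x 0 := hv hxL
      linarith
    · refine eval_eq_zero_of_local_extremum F 0 one_ne_zero hOo (hLW u huL) huL.1.2
        fun y hy hyF => ?_
      have h1 : y 0 ≤ u 0 := hu (hWL y hy hyF)
      linarith
    · refine eval_eq_zero_of_local_extremum F 0 (neg_ne_zero.2 one_ne_zero) hOo (hLW v hvL)
        hvL.1.2 fun y hy hyF => ?_
      have h1 : v 0 ≤ y 0 := hv (hWL y hy hyF)
      linarith
  by_contra! hlt
  refine htbad ?_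
  choose! u v hu hv huv hu0 hv0 using hext
  have hUd : ∀ x ∈ S, ∀ y ∈ S, ∀ z ∈ U x, z ∈ U y → x = y := by
    intro x hx y hy z hzx hzy
    by_contra hxy
    exact Set.disjoint_left.1 ((hUV x hx).2.2.2.2.2 y hy hxy) hzx hzy
  refine ⟨S.image u ∪ S.image v, ?_, ?_⟩
  · rw [Finset.card_union_of_disjoint, Finset.card_image_of_injOn, Finset.card_image_of_injOn]
    · omega
    · intro x hx y hy hxy
      exact hUd x hx y hy _ (hv x hx) (by rw [hxy]; exact hv y hy)
    · intro x hx y hy hxy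
      exact hUd x hx y hy _ (hu x hx) (by rw [hxy]; exact hu y hy)
    · refine Finset.disjoint_left.2 fun z hz hz' => ?_
      obtain ⟨x, hx, rfl⟩ := Finset.mem_image.1 hz
      obtain ⟨y, hy, hxy⟩ := Finset.mem_image.1 hz'
      obtain rfl : x = y := hUd x hx y hy _ (hu x hx) (by rw [← hxy]; exact hv y hy)
      exact huv x hx hxy.symm
  · intro z hz
    rcases Finset.mem_union.1 hz with hz | hz
    · obtain ⟨x, hx, rfl⟩ := Finset.mem_image.1 hz
      rw [← hF]
      exact hu0 x hx
    · obtain ⟨x, hx, rfl⟩ := Finset.mem_image.1 hz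
      rw [← hF]
      exact hv0 x hx

/-- The bound for basic sets. -/
lemma card_le_of_disconnected_basicSet {m J : ℕ} (q : Fin J → MvPolynomial (Fin (m + 1)) ℝ)
    (strict : Fin J → Bool) {d : ℕ} (hd : ∑ j, (q j).totalDegree ≤ d)
    (S : Finset (Fin (m + 1) → ℝ)) (hSq : ∀ x ∈ S, x ∈ ⋂ j, basicSet (q j) (strict j))
    (hS : ∀ x ∈ S, ∀ y ∈ S, x ≠ y → Disconnected (⋂ j, basicSet (q j) (strict j)) x y) :
    2 * S.card ≤ (d + 2) * (d + 1) ^ m := by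
  obtain ⟨ε, hε, hε0⟩ : ∃ ε : ℝ, (∀ x ∈ S, ∀ j, strict j = true → ε < eval x (q j)) ∧ 0 < ε := by
    refine Filter.Eventually.exists (f := nhdsWithin 0 (Set.Ioi 0))
      (Filter.Eventually.and ?_ self_mem_nhdsWithin)
    refine (Filter.eventually_all_finset S).2 fun x hx => Filter.eventually_all.2 fun j => ?_
    by_cases h : strict j = true
    · have h1 := Set.mem_iInter.1 (hSq x hx) j
      rw [basicSet, if_pos h] at h1
      exact ((eventually_lt_nhds h1).filter_mono nhdsWithin_le_nhds).mono fun s hs _ => hs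
    · exact Filter.Eventually.of_forall fun s hs => absurd hs h
  refine card_le_of_disconnected_closed (fun j => if strict j then q j - C ε else q j)
    ((Finset.sum_le_sum fun j _ => ?_).trans hd) S (fun x hx j => ?_)
    fun x hx y hy hxy => (hS x hx y hy hxy).mono fun z hz => Set.mem_iInter.2 fun j => ?_
  · split_ifs
    · exact totalDegree_sub_C_le _ _
    · exact le_rfl
  · split_ifs with h
    · simpa using (hε x hx j h).le
    · have h1 := Set.mem_iInter.1 (hSq x hx) j
      rw [basicSet, if_neg h] at h1
      exact h1
  · have h1 := hz j
    rw [basicSet]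
    split_ifs at h1 ⊢
    · rw [map_sub, eval_C] at h1
      exact lt_of_lt_of_le hε0 (sub_nonneg.1 h1)
    · exact h1

lemma totalDegree_bind₁_le {σ τ : Type*} (φ : σ → MvPolynomial τ ℝ)
    (hφ : ∀ k, (φ k).totalDegree ≤ 1) (p : MvPolynomial σ ℝ) :
    (bind₁ φ p).totalDegree ≤ p.totalDegree := by
  rw [bind₁, aeval_def, eval₂_eq]
  refine totalDegree_finsetSum_le fun α hα => (totalDegree_mul _ _).trans ?_
  rw [algebraMap_eq, totalDegree_C, zero_add]
  refine (totalDegree_finsetProd _ _).trans (le_trans ?_ (le_totalDegree hα))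
  refine Finset.sum_le_sum fun i _ => (totalDegree_pow _ _).trans ?_
  simpa using Nat.mul_le_mul_left (α i) (hφ i)

lemma exists_affine_parametrization {n ℓ : ℕ} (P : AffineSubspace ℝ (Fin n → ℝ))
    (hP : Module.finrank ℝ P.direction = ℓ) {x₀ : Fin n → ℝ} (hx₀ : x₀ ∈ P) :
    ∃ φ : Fin n → MvPolynomial (Fin ℓ) ℝ, (∀ k, (φ k).totalDegree ≤ 1) ∧
      (∀ y, (fun k => eval y (φ k)) ∈ P) ∧ ∀ x ∈ P, ∃ y, (fun k => eval y (φ k)) = x := by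
  let b := Module.finBasisOfFinrankEq ℝ P.direction hP
  let φ : Fin n → MvPolynomial (Fin ℓ) ℝ := fun k =>
    C (x₀ k) + ∑ i, C ((b i : Fin n → ℝ) k) * X i
  have hφe : ∀ y : Fin ℓ → ℝ, (fun k => eval y (φ k)) =
      ((∑ i, y i • b i : P.direction) : Fin n → ℝ) + x₀ := by
    intro y
    ext k
    simp [φ, add_comm, mul_comm]
  refine ⟨φ, fun k => ?_, fun y => ?_, fun x hx => ?_⟩
  · refine (totalDegree_add _ _).trans (max_le (by simp) ?_)
    refine totalDegree_finsetSum_le fun i _ => (totalDegree_mul _ _).trans ?_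
    simp
  · rw [hφe]
    exact AffineSubspace.vadd_mem_of_mem_direction (Subtype.coe_prop _) hx₀
  · refine ⟨b.repr ⟨x - x₀, AffineSubspace.vsub_mem_direction hx hx₀⟩, ?_⟩
    rw [hφe, b.sum_repr]
    simp

/-- For a semialgebraic set `A = ⋃_{i=1}^k ⋂_{j=1}^{j_i} A_{ij}`, where each `A_{ij}` is
`{x : p_{ij}(x) > 0}` or `{x : p_{ij}(x) ≥ 0}` with `deg p_{ij} = d_{ij}`, and
`d_i = Σ_j d_{ij}`, the number of connected components of `A ∩ P`, for any
`ℓ`-dimensional affine subspace `P` of `ℝ^n` with `ℓ ≥ 1`, is at most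
`(1/2) Σ_i (d_i + 2)(d_i + 1)^{ℓ-1}`. -/
theorem stmt16 {n k : ℕ} (J : Fin k → ℕ)
    (p : (i : Fin k) → Fin (J i) → MvPolynomial (Fin n) ℝ)
    (strict : (i : Fin k) → Fin (J i) → Bool)
    (A : Set (Fin n → ℝ)) (hA : A = ⋃ i, ⋂ j, basicSet (p i j) (strict i j))
    (d : Fin k → ℕ) (hd : ∀ i, d i = ∑ j, (p i j).totalDegree)
    (ℓ : ℕ) (hℓ : 1 ≤ ℓ) (P : AffineSubspace ℝ (Fin n → ℝ))
    (hP : Module.finrank ℝ P.direction = ℓ) :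
    (compsIn (A ∩ (P : Set (Fin n → ℝ)))).Finite ∧
      ((compsIn (A ∩ (P : Set (Fin n → ℝ)))).ncard : ℝ) ≤
        (1 / 2) * ∑ i, ((d i : ℝ) + 2) * ((d i : ℝ) + 1) ^ (ℓ - 1) := by
  classical
  obtain ⟨m, rfl⟩ : ∃ m, ℓ = m + 1 := ⟨ℓ - 1, by omega⟩
  obtain ⟨x₀, hx₀⟩ : (P : Set (Fin n → ℝ)).Nonempty := by
    rw [AffineSubspace.nonempty_iff_ne_bot]
    rintro rfl
    rw [AffineSubspace.direction_bot, finrank_bot] at hP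
    omega
  obtain ⟨φ, hφ, hφP, hPφ⟩ := exists_affine_parametrization P hP hx₀
  have hφc : Continuous fun y : Fin (m + 1) → ℝ => fun k => eval y (φ k) :=
    continuous_pi fun k => continuous_eval (φ k)
  have hbasic : ∀ (y : Fin (m + 1) → ℝ) (r : MvPolynomial (Fin n) ℝ) (s : Bool),
      y ∈ basicSet (bind₁ φ r) s ↔ (fun k => eval y (φ k)) ∈ basicSet r s := by
    intro y r s
    have h : eval y (bind₁ φ r) = eval (fun k => eval y (φ k)) r := eval₂Hom_bind₁ _ _ _ _
    unfold basicSet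
    split_ifs <;> simp only [Set.mem_ofPred_eq, h]
  have hbound : ∀ 𝒯 : Finset (Set (Fin n → ℝ)), (𝒯 : Set (Set (Fin n → ℝ))) ⊆
      compsIn (A ∩ (P : Set (Fin n → ℝ))) →
      2 * 𝒯.card ≤ ∑ i, (d i + 2) * (d i + 1) ^ m := by
    intro 𝒯 h𝒯
    have hrep : ∀ T ∈ 𝒯, ∃ (i : Fin k) (y : Fin (m + 1) → ℝ),
        (fun k => eval y (φ k)) ∈ ⋂ j, basicSet (p i j) (strict i j) ∧
        T = connectedComponentIn (A ∩ P) (fun k => eval y (φ k)) := by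
      intro T hT
      obtain ⟨x, ⟨hxA, hxP⟩, rfl⟩ := h𝒯 hT
      rw [hA, Set.mem_iUnion] at hxA
      obtain ⟨i, hi⟩ := hxA
      obtain ⟨y, rfl⟩ := hPφ x hxP
      exact ⟨i, y, hi, rfl⟩
    rcases 𝒯.eq_empty_or_nonempty with rfl | ⟨T₀, hT₀⟩
    · simp
    have : Nonempty (Fin k) := ⟨(hrep T₀ hT₀).choose⟩
    choose! i y hy hT using hrep
    rw [Finset.card_eq_sum_card_fiberwise (f := i) (t := Finset.univ) fun _ _ => by simp,
      Finset.mul_sum]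
    refine Finset.sum_le_sum fun i₀ _ => ?_
    have hinj : Set.InjOn y (𝒯.filter fun T => i T = i₀) := by
      intro T hT' T' hT'' h
      rw [hT T (Finset.mem_filter.1 hT').1, hT T' (Finset.mem_filter.1 hT'').1, h]
    rw [← Finset.card_image_of_injOn hinj]
    refine card_le_of_disconnected_basicSet (fun j => bind₁ φ (p i₀ j)) (strict i₀) ?_ _ ?_ ?_
    · rw [hd]
      exact Finset.sum_le_sum fun j _ => totalDegree_bind₁_le φ hφ _
    · intro z hz
      obtain ⟨T, hT', rfl⟩ := Finset.mem_image.1 hz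
      obtain ⟨hT1, rfl⟩ := Finset.mem_filter.1 hT'
      exact Set.mem_iInter.2 fun j => (hbasic _ _ _).2 (Set.mem_iInter.1 (hy T hT1) j)
    · intro z hz z' hz' hne R hR hRc hzR hzR'
      obtain ⟨T, hT', rfl⟩ := Finset.mem_image.1 hz
      obtain ⟨T', hT'', rfl⟩ := Finset.mem_image.1 hz'
      have h1 := (Finset.mem_filter.1 hT').1
      have h2 := (Finset.mem_filter.1 hT'').1
      refine hne (congrArg y ?_)
      rw [hT T h1, hT T' h2]
      refine connectedComponentIn_eq ((hRc.image _ hφc.continuousOn).subset_connectedComponentIn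
        ⟨_, hzR, rfl⟩ ?_ ⟨_, hzR', rfl⟩)
      rintro _ ⟨w, hw, rfl⟩
      refine ⟨?_, hφP w⟩
      rw [hA]
      exact Set.mem_iUnion.2 ⟨i₀, Set.mem_iInter.2 fun j =>
        (hbasic _ _ _).1 (Set.mem_iInter.1 (hR hw) j)⟩
  have hfin : (compsIn (A ∩ (P : Set (Fin n → ℝ)))).Finite := by
    by_contra hinf
    obtain ⟨𝒯, h𝒯, hcard⟩ := Set.Infinite.exists_subset_card_eq hinf
      (∑ i, (d i + 2) * (d i + 1) ^ m + 1)
    have := hbound 𝒯 h𝒯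
    omega
  refine ⟨hfin, ?_⟩
  have h := hbound hfin.toFinset (by simp)
  rw [← Set.ncard_eq_toFinset_card _ hfin] at h
  have h' : (2 : ℝ) * ((compsIn (A ∩ (P : Set (Fin n → ℝ)))).ncard : ℝ) ≤
      ∑ i, ((d i : ℝ) + 2) * ((d i : ℝ) + 1) ^ m := by exact_mod_cast h
  rw [Nat.add_sub_cancel]
  linarith
end
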